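/- arXiv:2305.06009 — 8 statements merged into one kernel-verified Lean document; each statement's English description precedes it below -/
import Mathlib

section
/- For every φ ∈ C(S×P) and every ε > 0 there exist constants C₂ = C₂(ν,φ,ε) > 0 and c₂ = c₂(ν,φ,ε) > 0 such that for every [v] ∈ P and every N ∈ ℕ there exists a measurable set ℰ₂ ⊂ G^ℕ satisfying: (1) ν^ℕ(ℰ₂^c) ≤ C₂ e^{−c₂N}, and (2) (1/n) ∑_{j=0}^{n−1} φ(g_j, (g_j g_{j−1} ⋯ g_0)·[v]) < Σ(ν,φ) + ε for every 𝐠 = (g_0,g_1,…) ∈ ℰ₂ and every n ≥ N. -/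
open MeasureTheory Filter Topology
open scoped ENNReal

noncomputable section

abbrev Euc (d : ℕ) := EuclideanSpace ℝ (Fin d)
abbrev Md (d : ℕ) := Euc d →L[ℝ] Euc d

/-- The group `G = GL(d,ℝ)`, realized as the group of units of the algebra of linear
endomorphisms of `ℝ^d`. -/
abbrev GLd (d : ℕ) := (Md d)ˣ

/-- The real projective space `P = P(ℝ^d)`. -/
abbrev Pd (d : ℕ) := Projectivization ℝ (Euc d)

instance (d : ℕ) : TopologicalSpace (Pd d) :=
  inferInstanceAs (TopologicalSpace (Quotient (projectivizationSetoid ℝ (Euc d))))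

instance (d : ℕ) : MeasurableSpace (Pd d) := borel _

/-- The projective action of `GL(d,ℝ)` on `P(ℝ^d)`: `g • [v] = [g v]`. -/
def pact {d : ℕ} (g : GLd d) (x : Pd d) : Pd d :=
  Projectivization.map ((g : Md d) : Euc d →ₗ[ℝ] Euc d)
    (by
      have h : Function.LeftInverse (⇑((g⁻¹ : GLd d) : Md d)) (⇑((g : GLd d) : Md d)) := by
        intro v
        have h1 : ((g⁻¹ : GLd d) : Md d) * ((g : GLd d) : Md d) = 1 := g.inv_mul
        calc ((g⁻¹ : GLd d) : Md d) (((g : GLd d) : Md d) v)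
            = (((g⁻¹ : GLd d) : Md d) * ((g : GLd d) : Md d)) v := rfl
          _ = v := by rw [h1]; rfl
      exact h.injective) x

/-- The (topological) support of a measure. -/
def msupport {α : Type*} [TopologicalSpace α] [MeasurableSpace α] (μ : Measure α) : Set α :=
  {x | ∀ u : Set α, IsOpen u → x ∈ u → 0 < μ u}

/-- The measure `ν`, viewed as a measure on its (compact) support `S`. -/
def nuS {d : ℕ} (ν : Measure (GLd d)) : Measure (↥(msupport ν)) :=
  ν.comap Subtype.val

/-- The operator `Q_ν` on functions on `S × P`:
`(Q_ν ψ)(g′, x) = ∫_S ψ(g, g • x) dν(g)` (the value does not depend on `g′`). -/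
def Qop {d : ℕ} (ν : Measure (GLd d)) (ψ : ↥(msupport ν) × Pd d → ℝ) :
    ↥(msupport ν) × Pd d → ℝ :=
  fun p => ∫ g : ↥(msupport ν), ψ (g, pact (g : GLd d) p.2) ∂(nuS ν)

/-- A Borel probability measure `lam` on `S × P` is `Q_ν`-invariant if
`∫ Q_ν ψ dlam = ∫ ψ dlam` for every continuous (bounded) `ψ`. -/
def QInv {d : ℕ} (ν : Measure (GLd d)) (lam : Measure (↥(msupport ν) × Pd d)) : Prop :=
  ∀ ψ : BoundedContinuousFunction (↥(msupport ν) × Pd d) ℝ,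
    ∫ p, Qop ν (⇑ψ) p ∂lam = ∫ p, ψ p ∂lam

/-- `Σ(ν,φ) = sup { ∫ φ dlam : lam a Q_ν-invariant Borel probability measure on S × P }`. -/
def SigmaSup {d : ℕ} (ν : Measure (GLd d))
    (φ : BoundedContinuousFunction (↥(msupport ν) × Pd d) ℝ) : ℝ :=
  sSup {r : ℝ | ∃ lam : Measure (↥(msupport ν) × Pd d),
    IsProbabilityMeasure lam ∧ QInv ν lam ∧ r = ∫ p, φ p ∂lam}


/-! ### The transfer operator of a random continuous action on a compact space -/

section Transfer

variable {S P : Type*} [TopologicalSpace S] [MeasurableSpace S] [TopologicalSpace P]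
  (m : Measure S) [IsProbabilityMeasure m] {α : S → P → P}

lemma abs_integral_step_le (ψ : BoundedContinuousFunction (S × P) ℝ) (x : P) :
    |∫ g, ψ (g, α g x) ∂m| ≤ ‖ψ‖ := by
  have := norm_integral_le_of_norm_le_const (μ := m) (f := fun g => ψ (g, α g x))
    (ae_of_all _ fun g => ψ.norm_coe_le_norm _)
  simpa using this

variable [BorelSpace S] (hα : Continuous (Function.uncurry α))

include hα in
lemma integrable_step (ψ : BoundedContinuousFunction (S × P) ℝ) (x : P) :
    Integrable (fun g => ψ (g, α g x)) m := by
  refine Integrable.of_bound (C := ‖ψ‖) (Continuous.aestronglyMeasurable ?_)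
    (ae_of_all _ fun g => ψ.norm_coe_le_norm _)
  exact ψ.continuous.comp (continuous_id.prodMk (hα.comp (continuous_id.prodMk continuous_const)))

variable [SecondCountableTopology P]

include hα in
/-- The average of a continuous observable over one random step depends continuously on the
starting point. -/
lemma continuous_integral_step (ψ : BoundedContinuousFunction (S × P) ℝ) :
    Continuous fun x : P => ∫ g, ψ (g, α g x) ∂m := by
  refine continuous_of_dominated (bound := fun _ => ‖ψ‖) (fun x => ?_)
    (fun x => ae_of_all _ fun g => ψ.norm_coe_le_norm _) (integrable_const _)
    (ae_of_all _ fun g => ?_)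
  · refine Continuous.aestronglyMeasurable ?_
    exact ψ.continuous.comp (continuous_id.prodMk (hα.comp (continuous_id.prodMk continuous_const)))
  · exact ψ.continuous.comp
      (continuous_const.prodMk (hα.comp (continuous_const.prodMk continuous_id)))

/-- The transfer operator as a linear endomorphism of the space of continuous observables. -/
def transferOp : BoundedContinuousFunction (S × P) ℝ →ₗ[ℝ] BoundedContinuousFunction (S × P) ℝ where
  toFun ψ := BoundedContinuousFunction.ofNormedAddCommGroup
    (fun p : S × P => ∫ g, ψ (g, α g p.2) ∂m)
    ((continuous_integral_step m hα ψ).comp continuous_snd) ‖ψ‖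
    (fun p => abs_integral_step_le m ψ p.2)
  map_add' ψ₁ ψ₂ := by
    ext p
    exact integral_add (integrable_step m hα ψ₁ p.2) (integrable_step m hα ψ₂ p.2)
  map_smul' c ψ := by
    ext p
    exact integral_const_mul c _

lemma transferOp_apply (ψ : BoundedContinuousFunction (S × P) ℝ) (p : S × P) :
    transferOp m hα ψ p = ∫ g, ψ (g, α g p.2) ∂m := rfl

lemma transferOp_nonneg {ψ : BoundedContinuousFunction (S × P) ℝ} (h : ∀ p, 0 ≤ ψ p) (p : S × P) :
    0 ≤ transferOp m hα ψ p := integral_nonneg fun _ => h _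

lemma transferOp_pow_nonneg {ψ : BoundedContinuousFunction (S × P) ℝ} (h : ∀ p, 0 ≤ ψ p) (j : ℕ)
    (p : S × P) : 0 ≤ (transferOp m hα ^ j) ψ p := by
  induction j generalizing p with
  | zero => exact h p
  | succ j ih =>
    rw [pow_succ', Module.End.mul_apply]
    exact transferOp_nonneg m hα ih p

lemma transferOp_pow_one (j : ℕ) :
    (transferOp m hα ^ j) (1 : BoundedContinuousFunction (S × P) ℝ) = 1 := by
  induction j with
  | zero => rfl
  | succ j ih =>
    rw [pow_succ', Module.End.mul_apply, ih]
    ext p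
    simp [transferOp_apply]

lemma abs_transferOp_pow_le (ψ : BoundedContinuousFunction (S × P) ℝ) (j : ℕ) (p : S × P) :
    |(transferOp m hα ^ j) ψ p| ≤ ‖ψ‖ := by
  induction j generalizing p with
  | zero => exact ψ.norm_coe_le_norm p
  | succ j ih =>
    rw [pow_succ', Module.End.mul_apply]
    exact (abs_integral_step_le m _ p.2).trans
      ((BoundedContinuousFunction.norm_le (norm_nonneg _)).2 ih)

/-- The Birkhoff average of the first `n` iterates of the transfer operator. -/
def transferAvg (n : ℕ) :
    BoundedContinuousFunction (S × P) ℝ →ₗ[ℝ] BoundedContinuousFunction (S × P) ℝ :=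
  (n : ℝ)⁻¹ • ∑ j ∈ Finset.range n, transferOp m hα ^ j

lemma transferAvg_apply (n : ℕ) (ψ : BoundedContinuousFunction (S × P) ℝ) (p : S × P) :
    transferAvg m hα n ψ p = (n : ℝ)⁻¹ * ∑ j ∈ Finset.range n, (transferOp m hα ^ j) ψ p := by
  simp [transferAvg, LinearMap.sum_apply]

lemma abs_transferAvg_le (n : ℕ) (ψ : BoundedContinuousFunction (S × P) ℝ) (p : S × P) :
    |transferAvg m hα n ψ p| ≤ ‖ψ‖ := by
  rw [transferAvg_apply, abs_mul, abs_inv, Nat.abs_cast]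
  rcases Nat.eq_zero_or_pos n with rfl | hn
  · simp
  rw [inv_mul_le_iff₀ (by exact_mod_cast hn)]
  calc _ ≤ ∑ j ∈ Finset.range n, |(transferOp m hα ^ j) ψ p| := Finset.abs_sum_le_sum_abs _ _
    _ ≤ ∑ j ∈ Finset.range n, ‖ψ‖ :=
      Finset.sum_le_sum fun j _ => abs_transferOp_pow_le m hα ψ j p
    _ = n * ‖ψ‖ := by simp

lemma abs_transferAvg_transferOp_sub_le (n : ℕ) (ψ : BoundedContinuousFunction (S × P) ℝ)
    (p : S × P) :
    |transferAvg m hα n (transferOp m hα ψ) p - transferAvg m hα n ψ p| ≤ 2 * ‖ψ‖ * (n : ℝ)⁻¹ := by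
  have h : transferAvg m hα n (transferOp m hα ψ) p - transferAvg m hα n ψ p =
      (n : ℝ)⁻¹ * ((transferOp m hα ^ n) ψ p - ψ p) := by
    rw [transferAvg_apply, transferAvg_apply, ← mul_sub, ← Finset.sum_sub_distrib]
    simp_rw [← Module.End.mul_apply, ← pow_succ]
    rw [Finset.sum_range_sub fun j => (transferOp m hα ^ j) ψ p]
    rfl
  rw [h, abs_mul, abs_inv, Nat.abs_cast, mul_comm]
  refine mul_le_mul_of_nonneg_right ?_ (by positivity)
  have h₁ := abs_transferOp_pow_le m hα ψ n p
  have h₂ : |ψ p| ≤ ‖ψ‖ := ψ.norm_coe_le_norm p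
  calc _ ≤ |(transferOp m hα ^ n) ψ p| + |ψ p| := abs_sub _ _
    _ ≤ 2 * ‖ψ‖ := by linarith

/-- The sum of the observable `f` along the first `n` points of a random trajectory started at `x`,
plus the value of `H` at the end point. -/
def trajSum (α : S → P → P) (f : S × P → ℝ) (H : P → ℝ) : (n : ℕ) → (Fin n → S) → P → ℝ
  | 0, _, x => H x
  | n + 1, w, x => f (w 0, α (w 0) x) + trajSum α f H n (fun i => w i.succ) (α (w 0) x)

omit [MeasurableSpace S] [BorelSpace S] [SecondCountableTopology P] in
include hα in
lemma continuous_trajSum {f : S × P → ℝ} {H : P → ℝ} (hf : Continuous f) (hH : Continuous H)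
    (n : ℕ) : Continuous fun q : (Fin n → S) × P => trajSum α f H n q.1 q.2 := by
  induction n with
  | zero => exact hH.comp continuous_snd
  | succ n ih =>
    have h0 : Continuous fun q : (Fin (n + 1) → S) × P => q.1 0 :=
      (continuous_apply 0).comp continuous_fst
    have h1 : Continuous fun q : (Fin (n + 1) → S) × P => α (q.1 0) q.2 :=
      hα.comp (h0.prodMk continuous_snd)
    have h2 : Continuous fun q : (Fin (n + 1) → S) × P => fun i : Fin n => q.1 i.succ :=
      continuous_pi fun i => (continuous_apply _).comp continuous_fst
    exact (hf.comp (h0.prodMk h1)).add (ih.comp (h2.prodMk h1))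

/-- A Hoeffding-type bound for one step of the random walk. -/
lemma lintegral_exp_step_le (f h : BoundedContinuousFunction (S × P) ℝ)
    (hfh : ∀ p, f p ≤ h p - transferOp m hα h p) {t : ℝ} (ht : 0 ≤ t) (hth : t * (2 * ‖h‖) ≤ 1)
    (x : P) :
    ∫⁻ g, ENNReal.ofReal (Real.exp
        (t * (f (g, α g x) + ∫ g', h (g', α g' (α g x)) ∂m))) ∂m ≤
      ENNReal.ofReal (Real.exp (t * (∫ g, h (g, α g x) ∂m) + (t * (2 * ‖h‖)) ^ 2)) := by
  set c := ∫ g, h (g, α g x) ∂m with hc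
  have hi := integrable_step m hα h x
  have hbound (g : S) : |t * (h (g, α g x) - c)| ≤ t * (2 * ‖h‖) := by
    rw [abs_mul, abs_of_nonneg ht]
    refine mul_le_mul_of_nonneg_left ((abs_sub _ _).trans ?_) ht
    have h₁ : |h (g, α g x)| ≤ ‖h‖ := h.norm_coe_le_norm _
    have h₂ := abs_integral_step_le (α := α) m h x
    linarith
  have hpt (g : S) : Real.exp (t * (f (g, α g x) + ∫ g', h (g', α g' (α g x)) ∂m)) ≤
      Real.exp (t * c) * (1 + t * (h (g, α g x) - c) + (t * (2 * ‖h‖)) ^ 2) := by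
    have h₁ : f (g, α g x) + ∫ g', h (g', α g' (α g x)) ∂m ≤ h (g, α g x) := by
      have := hfh (g, α g x)
      rw [transferOp_apply] at this
      simp only at this
      linarith
    calc _ ≤ Real.exp (t * c + t * (h (g, α g x) - c)) := by
          refine Real.exp_le_exp.2 ?_
          have := mul_le_mul_of_nonneg_left h₁ ht
          linarith
      _ ≤ _ := by
          rw [Real.exp_add]
          refine mul_le_mul_of_nonneg_left ?_ (Real.exp_pos _).le
          have h₂ := Real.abs_exp_sub_one_sub_id_le ((hbound g).trans hth)
          have h₃ := sq_le_sq' (by linarith [(abs_le.1 (hbound g)).1]) (abs_le.1 (hbound g)).2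
          linarith [(abs_le.1 h₂).2]
  have h1 : Integrable (fun g => t * (h (g, α g x) - c)) m :=
    (hi.sub (integrable_const c)).const_mul t
  have hi' : Integrable (fun g => Real.exp (t * c) *
      (1 + t * (h (g, α g x) - c) + (t * (2 * ‖h‖)) ^ 2)) m :=
    (((integrable_const 1).add h1).add (integrable_const _)).const_mul _
  calc _ ≤ ∫⁻ g, ENNReal.ofReal (Real.exp (t * c) *
        (1 + t * (h (g, α g x) - c) + (t * (2 * ‖h‖)) ^ 2)) ∂m :=
        lintegral_mono fun g => ENNReal.ofReal_le_ofReal (hpt g)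
    _ = ENNReal.ofReal (∫ g, Real.exp (t * c) *
        (1 + t * (h (g, α g x) - c) + (t * (2 * ‖h‖)) ^ 2) ∂m) := by
        rw [ofReal_integral_eq_lintegral_ofReal hi'
          (ae_of_all _ fun g => (Real.exp_pos _).le.trans (hpt g))]
    _ ≤ _ := by
        refine ENNReal.ofReal_le_ofReal ?_
        have h0 : ∫ g, t * (h (g, α g x) - c) ∂m = 0 := by
          rw [integral_const_mul, integral_sub hi (integrable_const c)]
          simp [← hc]
        rw [integral_const_mul, integral_add (f := fun g => 1 + t * (h (g, α g x) - c))
            ((integrable_const 1).add h1) (integrable_const _),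
          integral_add (integrable_const _) h1, h0, Real.exp_add]
        refine mul_le_mul_of_nonneg_left ?_ (Real.exp_pos _).le
        simp only [integral_const, probReal_univ, one_smul, add_zero]
        linarith [Real.add_one_le_exp ((t * (2 * ‖h‖)) ^ 2)]

/-- Exponential moments of the sums along random trajectories. -/
lemma lintegral_exp_trajSum_le [SecondCountableTopology S] (f h : BoundedContinuousFunction (S × P) ℝ)
    (hfh : ∀ p, f p ≤ h p - transferOp m hα h p) {t : ℝ} (ht : 0 ≤ t) (hth : t * (2 * ‖h‖) ≤ 1)
    (n : ℕ) (x : P) :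
    ∫⁻ w, ENNReal.ofReal (Real.exp
        (t * trajSum α f (fun y => ∫ g, h (g, α g y) ∂m) n w x)) ∂(Measure.pi fun _ : Fin n => m) ≤
      ENNReal.ofReal (Real.exp (t * (∫ g, h (g, α g x) ∂m) + n * (t * (2 * ‖h‖)) ^ 2)) := by
  set H : P → ℝ := fun y => ∫ g, h (g, α g y) ∂m with hH
  have hHc : Continuous H := continuous_integral_step m hα h
  set b := (t * (2 * ‖h‖)) ^ 2
  induction n generalizing x with
  | zero => simp [trajSum, H]
  | succ n ih =>
    have hm : Measurable fun q : S × (Fin n → S) => ENNReal.ofReal (Real.exp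
        (t * (f (q.1, α q.1 x) + trajSum α f H n q.2 (α q.1 x)))) := by
      refine (Continuous.measurable ?_)
      have h1 : Continuous fun q : S × (Fin n → S) => α q.1 x :=
        hα.comp (continuous_fst.prodMk continuous_const)
      exact ENNReal.continuous_ofReal.comp (Real.continuous_exp.comp (continuous_const.mul
        ((f.continuous.comp (continuous_fst.prodMk h1)).add
          ((continuous_trajSum hα f.continuous hHc n).comp (continuous_snd.prodMk h1)))))
    have hmp := measurePreserving_piFinSuccAbove (fun _ : Fin (n + 1) => m) 0
    have hchange := hmp.lintegral_comp hm
    calc _ = ∫⁻ q, ENNReal.ofReal (Real.exp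
          (t * (f (q.1, α q.1 x) + trajSum α f H n q.2 (α q.1 x))))
            ∂(m.prod (Measure.pi fun _ : Fin n => m)) := hchange
      _ = ∫⁻ g, ∫⁻ w, ENNReal.ofReal (Real.exp (t * f (g, α g x))) * ENNReal.ofReal
          (Real.exp (t * trajSum α f H n w (α g x))) ∂(Measure.pi fun _ : Fin n => m) ∂m := by
          rw [lintegral_prod _ hm.aemeasurable]
          simp_rw [mul_add, Real.exp_add, ENNReal.ofReal_mul (Real.exp_pos _).le]
      _ ≤ ∫⁻ g, ENNReal.ofReal (Real.exp (n * b)) *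
          ENNReal.ofReal (Real.exp (t * (f (g, α g x) + H (α g x)))) ∂m := by
          refine lintegral_mono fun g => ?_
          rw [lintegral_const_mul' _ _ ENNReal.ofReal_ne_top]
          refine (mul_le_mul_right (ih (α g x)) _).trans_eq ?_
          rw [← ENNReal.ofReal_mul (Real.exp_pos _).le, ← ENNReal.ofReal_mul (Real.exp_pos _).le,
            ← Real.exp_add, ← Real.exp_add]
          congr 2
          ring
      _ ≤ ENNReal.ofReal (Real.exp (n * b)) * ENNReal.ofReal (Real.exp (t * H x + b)) := by
          rw [lintegral_const_mul' _ _ ENNReal.ofReal_ne_top]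
          exact mul_le_mul_right (lintegral_exp_step_le m hα f h hfh ht hth x) _
      _ = _ := by
          rw [← ENNReal.ofReal_mul (Real.exp_pos _).le, ← Real.exp_add]
          congr 2
          push_cast
          ring

/-- Exponential large deviation bound for the sums along random trajectories. -/
lemma measure_le_trajSum_le [SecondCountableTopology S] (f h : BoundedContinuousFunction (S × P) ℝ)
    (hfh : ∀ p, f p ≤ h p - transferOp m hα h p) {δ : ℝ} (hδ : 0 < δ) :
    ∃ C > (0 : ℝ), ∃ c > (0 : ℝ), ∀ n x, (Measure.pi fun _ : Fin n => m)
      {w | n * δ - ‖h‖ ≤ trajSum α f (fun y => ∫ g, h (g, α g y) ∂m) n w x} ≤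
        ENNReal.ofReal (C * Real.exp (-c * n)) := by
  set B := 2 * ‖h‖ with hB
  have hB0 : 0 ≤ B := by positivity
  obtain ⟨t, ht, htB, htδ⟩ : ∃ t > 0, t * B ≤ 1 ∧ t * B ^ 2 ≤ δ / 2 := by
    refine ⟨min (1 / (B + 1)) (δ / 2 / (B ^ 2 + 1)), by positivity, ?_, ?_⟩
    · calc _ ≤ 1 / (B + 1) * B := mul_le_mul_of_nonneg_right (min_le_left _ _) hB0
        _ ≤ 1 := by rw [div_mul_eq_mul_div, div_le_one (by positivity)]; linarith
    · calc _ ≤ δ / 2 / (B ^ 2 + 1) * B ^ 2 :=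
            mul_le_mul_of_nonneg_right (min_le_right _ _) (by positivity)
        _ ≤ δ / 2 := by
            rw [div_mul_eq_mul_div, div_le_iff₀ (by positivity)]
            nlinarith
  refine ⟨Real.exp (t * B), Real.exp_pos _, t * (δ / 2), by positivity, fun n x => ?_⟩
  have hsub : {w | n * δ - ‖h‖ ≤ trajSum α f (fun y => ∫ g, h (g, α g y) ∂m) n w x} ⊆
      {w | ENNReal.ofReal (Real.exp (t * (n * δ - ‖h‖))) ≤ ENNReal.ofReal (Real.exp
        (t * trajSum α f (fun y => ∫ g, h (g, α g y) ∂m) n w x))} := fun w hw =>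
    ENNReal.ofReal_le_ofReal (Real.exp_le_exp.2 (mul_le_mul_of_nonneg_left hw ht.le))
  have hcont : Continuous fun w : Fin n → S =>
      trajSum α f (fun y => ∫ g, h (g, α g y) ∂m) n w x :=
    (continuous_trajSum hα f.continuous (continuous_integral_step m hα h) n).comp
      (continuous_id.prodMk continuous_const)
  refine (measure_mono hsub).trans ((meas_ge_le_lintegral_div ?_ ?_ ENNReal.ofReal_ne_top).trans ?_)
  · exact (ENNReal.continuous_ofReal.comp (Real.continuous_exp.comp
      (continuous_const.mul hcont))).measurable.aemeasurable
  · simp [Real.exp_pos]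
  · refine (ENNReal.div_le_div_right
      (lintegral_exp_trajSum_le m hα f h hfh ht.le htB n x) _).trans ?_
    rw [← ENNReal.ofReal_div_of_pos (Real.exp_pos _), ← Real.exp_sub, ← Real.exp_add]
    refine ENNReal.ofReal_le_ofReal (Real.exp_le_exp.2 ?_)
    have h1 := (abs_le.1 (abs_integral_step_le (α := α) m h x)).2
    have h2 := mul_le_mul_of_nonneg_left h1 ht.le
    have h3 := mul_le_mul_of_nonneg_left htδ (mul_nonneg (Nat.cast_nonneg (α := ℝ) n) ht.le)
    rw [← hB]
    nlinarith

variable [CompactSpace S] [T2Space S]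
  [MeasurableSpace P] [BorelSpace P] [CompactSpace P] [T2Space P]

/-- Any choice of base points has an accumulation point of its empirical averages, which is an
invariant probability measure. -/
lemma exists_invariant_measure_of_le_transferAvg (φ : BoundedContinuousFunction (S × P) ℝ) {a : ℝ}
    (p : ℕ → S × P) (hp : ∀ n, a ≤ transferAvg m hα (n + 1) φ (p n)) :
    ∃ lam : Measure (S × P), IsProbabilityMeasure lam ∧
      (∀ ψ : BoundedContinuousFunction (S × P) ℝ,
        ∫ q, transferOp m hα ψ q ∂lam = ∫ q, ψ q ∂lam) ∧ a ≤ ∫ q, φ q ∂lam := by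
  let F : Filter ℕ := (hyperfilter ℕ).toFilter
  have hFtop : F ≤ atTop := Nat.hyperfilter_le_atTop
  have hlim (ψ : BoundedContinuousFunction (S × P) ℝ) :
      ∃ l, Tendsto (fun n => transferAvg m hα (n + 1) ψ (p n)) F (𝓝 l) := by
    obtain ⟨l, -, hl⟩ := (isCompact_Icc (a := -‖ψ‖) (b := ‖ψ‖)).ultrafilter_le_nhds
      ((hyperfilter ℕ).map fun n => transferAvg m hα (n + 1) ψ (p n))
      (by
        rw [le_principal_iff, Ultrafilter.mem_coe, Ultrafilter.mem_map]
        exact Filter.univ_mem' fun n => abs_le.1 (abs_transferAvg_le m hα (n + 1) ψ (p n)))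
    exact ⟨l, hl⟩
  choose L hL using hlim
  let ι (f : CompactlySupportedContinuousMap (S × P) ℝ) : BoundedContinuousFunction (S × P) ℝ :=
    BoundedContinuousFunction.mkOfCompact f.toContinuousMap
  let Λ₀ : CompactlySupportedContinuousMap (S × P) ℝ →ₗ[ℝ] ℝ :=
    { toFun := fun f => L (ι f)
      map_add' := fun f g => by
        refine tendsto_nhds_unique (hL (ι (f + g))) (((hL (ι f)).add (hL (ι g))).congr fun n => ?_)
        rw [show ι (f + g) = ι f + ι g from rfl, map_add]
        rfl
      map_smul' := fun c f => by
        refine tendsto_nhds_unique (hL (ι (c • f))) (((hL (ι f)).const_mul c).congr fun n => ?_)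
        rw [show ι (c • f) = c • ι f from rfl, map_smul]
        rfl }
  let Λ : CompactlySupportedContinuousMap (S × P) ℝ →ₚ[ℝ] ℝ :=
    PositiveLinearMap.mk₀ Λ₀ fun f hf => by
      refine ge_of_tendsto' (hL (ι f)) fun n => ?_
      rw [transferAvg_apply]
      exact mul_nonneg (by positivity)
        (Finset.sum_nonneg fun j _ => transferOp_pow_nonneg m hα (fun q => hf q) j _)
  set lam := RealRMK.rieszMeasure Λ
  have hint (ψ : BoundedContinuousFunction (S × P) ℝ) : ∫ q, ψ q ∂lam = L ψ :=
    RealRMK.integral_rieszMeasure Λ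
      { toContinuousMap := ψ.toContinuousMap
        hasCompactSupport' := HasCompactSupport.of_compactSpace _ }
  refine ⟨lam, ?_, fun ψ => ?_, ?_⟩
  · have h := hint 1
    have h1 : L 1 = 1 := by
      refine tendsto_nhds_unique (hL 1) (tendsto_const_nhds.congr fun n => ?_)
      rw [transferAvg_apply]
      simp_rw [transferOp_pow_one]
      simp only [BoundedContinuousFunction.coe_one, Pi.one_apply, Finset.sum_const,
        Finset.card_range, nsmul_eq_mul, mul_one]
      rw [inv_mul_cancel₀ (by positivity)]
    rw [h1] at h
    simp only [BoundedContinuousFunction.coe_one, Pi.one_apply, integral_const, smul_eq_mul,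
      mul_one] at h
    exact ⟨by simpa [Measure.real, ENNReal.toReal_eq_one_iff] using h⟩
  · rw [hint, hint, ← sub_eq_zero]
    refine tendsto_nhds_unique ((hL _).sub (hL ψ)) ?_
    refine squeeze_zero_norm (fun n => abs_transferAvg_transferOp_sub_le m hα (n + 1) ψ (p n)) ?_
    have : Tendsto (fun n : ℕ => 2 * ‖ψ‖ * ((n + 1 : ℕ) : ℝ)⁻¹) atTop (𝓝 (2 * ‖ψ‖ * 0)) :=
      ((tendsto_inv_atTop_nhds_zero_nat (𝕜 := ℝ)).comp (tendsto_add_atTop_nat 1)).const_mul _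
    rw [mul_zero] at this
    exact this.mono_left hFtop
  · rw [hint]
    exact ge_of_tendsto' (hL φ) hp

/-- Up to a coboundary, an observable is pointwise bounded by any number exceeding its integrals
against all invariant probability measures. -/
lemma exists_le_add_coboundary (φ : BoundedContinuousFunction (S × P) ℝ) {a : ℝ}
    (ha : ∀ lam : Measure (S × P), IsProbabilityMeasure lam →
      (∀ ψ : BoundedContinuousFunction (S × P) ℝ,
        ∫ q, transferOp m hα ψ q ∂lam = ∫ q, ψ q ∂lam) → ∫ q, φ q ∂lam < a) :
    ∃ h : BoundedContinuousFunction (S × P) ℝ, ∀ p, φ p ≤ a + h p - transferOp m hα h p := by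
  obtain ⟨n, hn⟩ : ∃ n, ∀ p, transferAvg m hα (n + 1) φ p < a := by
    by_contra! hcon
    choose p hp using hcon
    obtain ⟨lam, h1, h2, h3⟩ := exists_invariant_measure_of_le_transferAvg m hα φ p hp
    exact (ha lam h1 h2).not_ge h3
  refine ⟨((n + 1 : ℕ) : ℝ)⁻¹ • ∑ j ∈ Finset.range (n + 1), ∑ i ∈ Finset.range j,
    (transferOp m hα ^ i) φ, fun p => ?_⟩
  set h := ((n + 1 : ℕ) : ℝ)⁻¹ • ∑ j ∈ Finset.range (n + 1), ∑ i ∈ Finset.range j,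
    (transferOp m hα ^ i) φ with hh
  have key : h - transferOp m hα h = φ - transferAvg m hα (n + 1) φ := by
    rw [hh, map_smul, map_sum]
    refine (smul_sub _ _ _).symm.trans ?_
    rw [← Finset.sum_sub_distrib]
    have (j : ℕ) : ∑ i ∈ Finset.range j, (transferOp m hα ^ i) φ -
        transferOp m hα (∑ i ∈ Finset.range j, (transferOp m hα ^ i) φ) =
        φ - (transferOp m hα ^ j) φ := by
      rw [map_sum, ← Finset.sum_sub_distrib]
      simp_rw [← Module.End.mul_apply, ← pow_succ']
      rw [Finset.sum_range_sub' fun i => (transferOp m hα ^ i) φ]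
      rfl
    simp_rw [this]
    rw [Finset.sum_sub_distrib, smul_sub, transferAvg]
    congr 1
    · rw [Finset.sum_const, Finset.card_range, ← Nat.cast_smul_eq_nsmul ℝ, smul_smul,
        inv_mul_cancel₀ (by positivity), one_smul]
    · rw [LinearMap.smul_apply, LinearMap.sum_apply]
  have hkp : h p - transferOp m hα h p = φ p - transferAvg m hα (n + 1) φ p :=
    congrArg (fun f : BoundedContinuousFunction (S × P) ℝ => f p) key
  linarith [hn p]

end Transfer
/-! ### Topology of the projective space and of the projective action -/

section ProjectiveSpace

variable {d : ℕ}

instance : BorelSpace (Pd d) := ⟨rfl⟩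

lemma continuous_projectivization_mk' :
    Continuous (Projectivization.mk' ℝ : {v : Euc d // v ≠ 0} → Pd d) :=
  continuous_quotient_mk'

/-- The entries of the orthogonal projection onto a line. -/
def lineEntries (x : Pd d) : Fin d × Fin d → ℝ :=
  Projectivization.lift
    (fun (v : {v : Euc d // v ≠ 0}) (q : Fin d × Fin d) => v.1 q.1 * v.1 q.2 / ‖v.1‖ ^ 2)
    (by
      rintro ⟨v, hv⟩ ⟨w, hw⟩ t (rfl : v = t • w)
      have ht : t ≠ 0 := fun h => hv (by rw [h, zero_smul])
      ext q
      simp only [PiLp.smul_apply, smul_eq_mul, norm_smul, mul_pow, Real.norm_eq_abs, sq_abs]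
      rw [show t * w q.1 * (t * w q.2) = t ^ 2 * (w q.1 * w q.2) by ring,
        mul_div_mul_left _ _ (pow_ne_zero 2 ht)]) x

lemma lineEntries_mk (v : Euc d) (hv : v ≠ 0) (q : Fin d × Fin d) :
    lineEntries (Projectivization.mk ℝ v hv) q = v q.1 * v q.2 / ‖v‖ ^ 2 := rfl

lemma continuous_lineEntries : Continuous (lineEntries : Pd d → Fin d × Fin d → ℝ) := by
  refine continuous_quot_lift _ (continuous_pi fun q => Continuous.div ?_ ?_ ?_)
  · fun_prop
  · fun_prop
  · exact fun v => pow_ne_zero 2 (norm_ne_zero_iff.2 v.2)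

lemma lineEntries_injective : Function.Injective (lineEntries : Pd d → Fin d × Fin d → ℝ) := by
  intro x y hxy
  induction x using Projectivization.ind with | h v hv => ?_
  induction y using Projectivization.ind with | h w hw => ?_
  obtain ⟨i, hi⟩ : ∃ i, v i ≠ 0 := by
    by_contra! h
    exact hv (PiLp.ext h)
  have hv' : ‖v‖ ^ 2 ≠ 0 := pow_ne_zero 2 (norm_ne_zero_iff.2 hv)
  rw [Projectivization.mk_eq_mk_iff']
  refine ⟨w i / ‖w‖ ^ 2 * (‖v‖ ^ 2 / v i), PiLp.ext fun j => ?_⟩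
  have h := congrFun hxy (i, j)
  rw [lineEntries_mk, lineEntries_mk] at h
  simp only [PiLp.smul_apply, smul_eq_mul]
  rw [show w i / ‖w‖ ^ 2 * (‖v‖ ^ 2 / v i) * w j = w i * w j / ‖w‖ ^ 2 * (‖v‖ ^ 2 / v i) by ring,
    ← h]
  field_simp

instance : T2Space (Pd d) := .of_injective_continuous lineEntries_injective continuous_lineEntries

/-- The canonical map from the unit sphere to the projective space. -/
def sphereToProj (v : Metric.sphere (0 : Euc d) 1) : Pd d :=
  Projectivization.mk' ℝ ⟨v, ne_zero_of_mem_unit_sphere v⟩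

lemma continuous_sphereToProj : Continuous (sphereToProj : _ → Pd d) :=
  continuous_projectivization_mk'.comp (by fun_prop)

lemma sphereToProj_surjective : Function.Surjective (sphereToProj : _ → Pd d) := by
  intro x
  induction x using Projectivization.ind with | h v hv => ?_
  have hn : ‖v‖ ≠ 0 := norm_ne_zero_iff.2 hv
  refine ⟨⟨‖v‖⁻¹ • v, by simp [norm_smul, hn]⟩, ?_⟩
  exact (Projectivization.mk_eq_mk_iff' _ _ _ _ _).2 ⟨‖v‖⁻¹, rfl⟩

instance : CompactSpace (Pd d) :=
  sphereToProj_surjective.compactSpace continuous_sphereToProj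

instance : SecondCountableTopology (Pd d) :=
  (continuous_lineEntries.isClosedEmbedding lineEntries_injective).isEmbedding.secondCountableTopology

lemma pact_mul (a b : GLd d) (x : Pd d) : pact (a * b) x = pact a (pact b x) := by
  induction x using Projectivization.ind with | h v hv => rfl

lemma pact_one (x : Pd d) : pact (1 : GLd d) x = x := by
  induction x using Projectivization.ind with | h v hv => rfl

lemma continuous_pact_of_isCompact {s : Set (GLd d)} (hs : IsCompact s) :
    Continuous (Function.uncurry fun (g : s) (x : Pd d) => pact (g : GLd d) x) := by
  have : CompactSpace s := isCompact_iff_compactSpace.1 hs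
  have hq : IsQuotientMap (Prod.map id sphereToProj : s × Metric.sphere (0 : Euc d) 1 → s × Pd d) :=
    IsQuotientMap.of_surjective_continuous
      (Function.surjective_id.prodMap sphereToProj_surjective)
      (continuous_id.prodMap continuous_sphereToProj)
  rw [hq.continuous_iff]
  have hne (q : s × Metric.sphere (0 : Euc d) 1) : ((q.1 : GLd d) : Md d) (q.2 : Euc d) ≠ 0 := by
    intro h
    refine ne_zero_of_mem_unit_sphere q.2 ?_
    have h1 : ((((q.1 : GLd d)⁻¹ : GLd d) : Md d) * ((q.1 : GLd d) : Md d)) (q.2 : Euc d) = 0 := by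
      rw [mul_apply_eq_comp, h, map_zero]
    rwa [Units.inv_mul] at h1
  have hc : Continuous fun q : s × Metric.sphere (0 : Euc d) 1 =>
      (⟨((q.1 : GLd d) : Md d) (q.2 : Euc d), hne q⟩ : {v : Euc d // v ≠ 0}) := by
    refine Continuous.subtype_mk ?_ _
    exact (Units.continuous_val.comp (continuous_subtype_val.comp continuous_fst)).clm_apply
      (continuous_subtype_val.comp continuous_snd)
  exact continuous_projectivization_mk'.comp hc

end ProjectiveSpace

/-! ### The group and the support of the measure -/

section Support

variable {d : ℕ}

instance : SecondCountableTopology (GLd d) :=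
  have : ProperSpace (Md d) := FiniteDimensional.proper ℝ (Md d)
  Units.isOpenEmbedding_val.isEmbedding.secondCountableTopology

instance : BorelSpace (GLd d) := by
  refine ⟨?_⟩
  rw [(Units.isOpenEmbedding_val (R := Md d)).isEmbedding.eq_induced, borel_comap,
    ← BorelSpace.measurable_eq]
  rfl

lemma msupport_eq_support {X : Type*} [TopologicalSpace X] [MeasurableSpace X] (μ : Measure X) :
    msupport μ = μ.support := by
  ext x
  rw [Measure.support_eq_forall_isOpen]
  exact ⟨fun h u hx hu => h u hu hx, fun h u hu hx => h u hx hu⟩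

instance (ν : Measure (GLd d)) [IsProbabilityMeasure ν] : IsProbabilityMeasure (nuS ν) := by
  have hm : MeasurableSet (msupport ν) := by
    rw [msupport_eq_support]
    exact Measure.isClosed_support.measurableSet
  refine ⟨?_⟩
  rw [nuS, comap_subtype_coe_apply hm, Set.image_univ, Subtype.range_coe]
  have h0 : ν (msupport ν)ᶜ = 0 := by
    rw [msupport_eq_support]
    exact Measure.measure_compl_support
  exact (prob_compl_eq_zero_iff hm).1 h0

/-- The additive functional along a trajectory, in terms of products of group elements. -/
lemma trajSum_eq {s : Set (GLd d)} (f : s × Pd d → ℝ) (H : Pd d → ℝ) (n : ℕ) (gs : ℕ → s)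
    (x : Pd d) :
    trajSum (fun (g : s) (x : Pd d) => pact (g : GLd d) x) f H n (fun i => gs i) x =
      ∑ j ∈ Finset.range n, f (gs j, pact ((List.ofFn fun i : Fin (j + 1) =>
        ((gs (i : ℕ) : GLd d))).reverse.prod) x) +
      H (pact ((List.ofFn fun i : Fin n => ((gs (i : ℕ) : GLd d))).reverse.prod) x) := by
  have hprod (k : ℕ) (gs : ℕ → s) (x : Pd d) :
      pact ((List.ofFn fun i : Fin (k + 1) => ((gs (i : ℕ) : GLd d))).reverse.prod) x =
      pact ((List.ofFn fun i : Fin k => ((gs (i + 1 : ℕ) : GLd d))).reverse.prod)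
        (pact (gs 0 : GLd d) x) := by
    rw [List.ofFn_succ, List.reverse_cons, List.prod_append, pact_mul]
    simp
  induction n generalizing gs x with
  | zero => simp [trajSum, pact_one]
  | succ n ih =>
    have h := ih (fun k => gs (k + 1)) (pact (gs 0 : GLd d) x)
    rw [Finset.sum_range_succ', hprod n]
    simp_rw [hprod (_ + 1)]
    have h0 : pact ((List.ofFn fun i : Fin (0 + 1) => ((gs (i : ℕ) : GLd d))).reverse.prod) x =
        pact (gs 0 : GLd d) x := by simp
    rw [h0]
    simp only [trajSum, Fin.val_succ, Fin.val_zero] at h ⊢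
    rw [h]
    ring



lemma bddAbove_integral_QInv (ν : Measure (GLd d))
    (φ : BoundedContinuousFunction (↥(msupport ν) × Pd d) ℝ) :
    BddAbove {r : ℝ | ∃ lam : Measure (↥(msupport ν) × Pd d),
      IsProbabilityMeasure lam ∧ QInv ν lam ∧ r = ∫ p, φ p ∂lam} := by
  refine ⟨‖φ‖, ?_⟩
  rintro _ ⟨lam, _, -, rfl⟩
  have := norm_integral_le_of_norm_le_const (μ := lam) (f := φ)
    (ae_of_all _ fun p => φ.norm_coe_le_norm p)
  exact (le_abs_self _).trans (by simpa using this)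

/-- A union bound for a tail of exponentially small events. -/
lemma measure_iUnion_le_of_exp {Ω : Type*} [MeasurableSpace Ω] (μ : Measure Ω) {B : ℕ → Set Ω}
    {C c : ℝ} (hC : 0 < C) (hc : 0 < c)
    (hB : ∀ n : ℕ, μ (B n) ≤ ENNReal.ofReal (C * Real.exp (-c * n))) (N : ℕ) :
    μ (⋃ k, B (N + k)) ≤ ENNReal.ofReal (C / (1 - Real.exp (-c)) * Real.exp (-c * N)) := by
  have hr : Real.exp (-c) < 1 := Real.exp_lt_one_iff.2 (by linarith)
  have hs := (hasSum_geometric_of_lt_one (Real.exp_pos (-c)).le hr).mul_left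
    (C * Real.exp (-c * N))
  have hterm (k : ℕ) : C * Real.exp (-c * (N + k : ℕ)) =
      C * Real.exp (-c * N) * Real.exp (-c) ^ k := by
    rw [← Real.exp_nat_mul, mul_assoc, ← Real.exp_add]
    push_cast
    ring_nf
  calc μ (⋃ k, B (N + k)) ≤ ∑' k, μ (B (N + k)) := measure_iUnion_le _
    _ ≤ ∑' k, ENNReal.ofReal (C * Real.exp (-c * N) * Real.exp (-c) ^ k) :=
        ENNReal.tsum_le_tsum fun k => (hB (N + k)).trans_eq (by rw [hterm])
    _ = ENNReal.ofReal (C / (1 - Real.exp (-c)) * Real.exp (-c * N)) := by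
        rw [← ENNReal.ofReal_tsum_of_nonneg (fun k => by positivity) hs.summable, hs.tsum_eq]
        congr 1
        ring

end Support

/-- **Lemma 4.5.** Let `ν` be a compactly supported Borel probability measure on `G = GL(d,ℝ)`
with support `S`, and `μ = ν^ℕ` the Bernoulli measure (characterized by its finite-dimensional
marginals).  For every `φ ∈ C(S × P)` and `ε > 0` there exist `C₂ > 0` and `c₂ > 0` such that
for every `[v] ∈ P` and `N ∈ ℕ` there is a measurable set `ℰ₂` with `ν^ℕ(ℰ₂ᶜ) ≤ C₂ e^{−c₂ N}`
and `(1/n) ∑_{j<n} φ(g_j, (g_j ⋯ g₀) • [v]) < Σ(ν,φ) + ε` for every `𝐠 ∈ ℰ₂` and `n ≥ N`. -/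
theorem stmt5 (d : ℕ) (ν : Measure (GLd d)) [IsProbabilityMeasure ν]
    (hcs : IsCompact (msupport ν))
    (μ : Measure (ℕ → ↥(msupport ν))) [IsProbabilityMeasure μ]
    (hμ : ∀ n : ℕ, μ.map (fun g (i : Fin n) => g (i : ℕ)) =
      Measure.pi fun _ : Fin n => nuS ν)
    (φ : BoundedContinuousFunction (↥(msupport ν) × Pd d) ℝ)
    (ε : ℝ) (hε : 0 < ε) :
    ∃ C > (0 : ℝ), ∃ c > (0 : ℝ), ∀ x : Pd d, ∀ N : ℕ,
      ∃ E : Set (ℕ → ↥(msupport ν)), MeasurableSet E ∧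
        μ Eᶜ ≤ ENNReal.ofReal (C * Real.exp (-c * N)) ∧
        ∀ gs ∈ E, ∀ n : ℕ, N ≤ n →
          (n : ℝ)⁻¹ * ∑ j ∈ Finset.range n,
              φ (gs j, pact ((List.ofFn fun i : Fin (j + 1) =>
                ((gs (i : ℕ) : GLd d))).reverse.prod) x) <
            SigmaSup ν φ + ε := by
  have : CompactSpace (msupport ν) := isCompact_iff_compactSpace.1 hcs
  have hα := continuous_pact_of_isCompact hcs
  set A := SigmaSup ν φ + ε / 2 with hA
  obtain ⟨h, hh⟩ := exists_le_add_coboundary (nuS ν) hα φ (a := A) fun lam hlam hinv => by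
    have : ∫ p, φ p ∂lam ≤ SigmaSup ν φ :=
      le_csSup (bddAbove_integral_QInv ν φ) ⟨lam, hlam, hinv, rfl⟩
    linarith
  set f := φ - BoundedContinuousFunction.const _ A with hf
  have hfA (p) : f p = φ p - A := rfl
  obtain ⟨C, hC, c, hc, hbad⟩ := measure_le_trajSum_le (nuS ν) hα f h
    (fun p => by rw [hfA]; linarith [hh p]) (half_pos hε)
  have hr : 0 < 1 - Real.exp (-c) := by
    have : Real.exp (-c) < 1 := Real.exp_lt_one_iff.2 (by linarith)
    linarith
  refine ⟨1 + C / (1 - Real.exp (-c)), by positivity, c, hc, fun x N => ?_⟩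
  rcases Nat.eq_zero_or_pos N with rfl | hN
  · refine ⟨∅, MeasurableSet.empty, ?_, by simp⟩
    rw [Set.compl_empty, measure_univ, ENNReal.one_le_ofReal]
    have : 0 < C / (1 - Real.exp (-c)) := by positivity
    simpa using this.le
  set H : Pd d → ℝ := fun y => ∫ g, h (g, pact (g : GLd d) y) ∂(nuS ν)
  let W (n : ℕ) : Set (Fin n → msupport ν) := {w | n * (ε / 2) - ‖h‖ ≤
    trajSum (fun (g : msupport ν) (x : Pd d) => pact (g : GLd d) x) f H n w x}
  let B (n : ℕ) : Set (ℕ → msupport ν) := (fun g (i : Fin n) => g (i : ℕ)) ⁻¹' W n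
  have hres (n : ℕ) : Measurable fun (g : ℕ → msupport ν) (i : Fin n) => g (i : ℕ) :=
    measurable_pi_lambda _ fun i => measurable_pi_apply _
  have hW (n : ℕ) : MeasurableSet (W n) := by
    refine measurableSet_le measurable_const (Continuous.measurable ?_)
    exact (continuous_trajSum hα f.continuous (continuous_integral_step (nuS ν) hα h) n).comp
      (continuous_id.prodMk continuous_const)
  have hB (n : ℕ) : μ (B n) ≤ ENNReal.ofReal (C * Real.exp (-c * n)) := by
    rw [← Measure.map_apply (hres n) (hW n), hμ n]
    exact hbad n x
  refine ⟨(⋃ k, B (N + k))ᶜ, (MeasurableSet.iUnion fun k => hres _ (hW _)).compl, ?_, ?_⟩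
  · rw [compl_compl]
    refine (measure_iUnion_le_of_exp μ hC hc hB N).trans (ENNReal.ofReal_le_ofReal ?_)
    exact mul_le_mul_of_nonneg_right (by linarith) (Real.exp_pos _).le
  · intro gs hgs n hn
    have hn0 : (0 : ℝ) < n := by exact_mod_cast hN.trans_le hn
    have hlt : trajSum (fun (g : msupport ν) (x : Pd d) => pact (g : GLd d) x) f H n
        (fun i => gs i) x < n * (ε / 2) - ‖h‖ := by
      refine not_le.1 fun hle => hgs (Set.mem_iUnion.2 ⟨n - N, ?_⟩)
      rw [Nat.add_sub_cancel' hn]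
      exact hle
    rw [trajSum_eq] at hlt
    simp_rw [hfA] at hlt
    rw [Finset.sum_sub_distrib, Finset.sum_const, Finset.card_range, nsmul_eq_mul] at hlt
    have hHle := (abs_le.1 (abs_integral_step_le
      (α := fun (g : msupport ν) (x : Pd d) => pact (g : GLd d) x) (nuS ν) h
      (pact ((List.ofFn fun i : Fin n => ((gs (i : ℕ) : GLd d))).reverse.prod) x))).1
    rw [inv_mul_lt_iff₀ hn0]
    have : (n : ℝ) * (SigmaSup ν φ + ε) = n * A + n * (ε / 2) := by rw [hA]; ring
    linarith

end
end

section
/- Let X and X′ be measurable spaces and η, η′ finite measures on X, X′ respectively with η(X) = η′(X′). Suppose A ⊂ X and A′ ⊂ X′ are measurable sets such that η(A) < η(X ∖ A) and η′(A′) < η′(X′ ∖ A′). Then there exists a coupling η̃ of η and η′ such that η̃(A × A′) = 0. -/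
open MeasureTheory

/-- Given finite measures `η` on `X` and `η′` on `X′` of equal total mass, and measurable sets
`A ⊆ X`, `A′ ⊆ X′` with `η A < η (X ∖ A)` and `η′ A′ < η′ (X′ ∖ A′)`, there exists a coupling
`η̃` of `η` and `η′` (a measure on `X × X′` whose marginals are `η` and `η′`) with
`η̃ (A × A′) = 0`. -/
theorem stmt9 {X X' : Type*} [MeasurableSpace X] [MeasurableSpace X']
    (η : Measure X) (η' : Measure X') [IsFiniteMeasure η] [IsFiniteMeasure η']
    (hmass : η Set.univ = η' Set.univ)
    (A : Set X) (A' : Set X') (hA : MeasurableSet A) (hA' : MeasurableSet A')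
    (h1 : η A < η Aᶜ) (h2 : η' A' < η' A'ᶜ) :
    ∃ ητ : Measure (X × X'), ητ.map Prod.fst = η ∧ ητ.map Prod.snd = η' ∧
      ητ (A ×ˢ A') = 0 := by
  have hsum : η A + η Aᶜ = η Set.univ := measure_add_measure_compl hA
  have hsum' : η' A' + η' A'ᶜ = η' Set.univ := measure_add_measure_compl hA'
  have hb0 : η Aᶜ ≠ 0 := (bot_le.trans_lt h1).ne'
  have hb0' : η' A'ᶜ ≠ 0 := (bot_le.trans_lt h2).ne'
  have hb : η Aᶜ ≠ ⊤ := measure_ne_top _ _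
  have hb' : η' A'ᶜ ≠ ⊤ := measure_ne_top _ _
  have hle : η' A' ≤ η Aᶜ := by
    by_contra! h
    have := ENNReal.add_lt_add (h1.trans h) (h.trans h2)
    rw [hsum, hsum', hmass] at this
    exact this.false
  obtain ⟨d, hd⟩ := exists_add_of_le hle
  have hd' : η' A'ᶜ = η A + d := by
    refine (ENNReal.add_right_inj (measure_ne_top η' A')).1 ?_
    rw [hsum', ← hmass, ← hsum, hd]
    ring
  have hcancel : (η Aᶜ)⁻¹ * η Aᶜ = 1 := ENNReal.inv_mul_cancel hb0 hb
  have hcancel' : (η' A'ᶜ)⁻¹ * η' A'ᶜ = 1 := ENNReal.inv_mul_cancel hb0' hb'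
  have hfst : (η Aᶜ)⁻¹ * η' A' + (η Aᶜ)⁻¹ * (η' A'ᶜ)⁻¹ * d * η' A'ᶜ = 1 := by
    calc _ = (η Aᶜ)⁻¹ * (η' A' + (η' A'ᶜ)⁻¹ * η' A'ᶜ * d) := by ring
      _ = 1 := by rw [hcancel', one_mul, ← hd, hcancel]
  have hsnd : (η' A'ᶜ)⁻¹ * η A + (η Aᶜ)⁻¹ * (η' A'ᶜ)⁻¹ * d * η Aᶜ = 1 := by
    calc _ = (η' A'ᶜ)⁻¹ * (η A + (η Aᶜ)⁻¹ * η Aᶜ * d) := by ring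
      _ = 1 := by rw [hcancel, one_mul, ← hd', hcancel']
  refine ⟨(η' A'ᶜ)⁻¹ • (η.restrict A).prod (η'.restrict A'ᶜ)
    + ((η Aᶜ)⁻¹ • (η.restrict Aᶜ).prod (η'.restrict A')
    + ((η Aᶜ)⁻¹ * (η' A'ᶜ)⁻¹ * d) • (η.restrict Aᶜ).prod (η'.restrict A'ᶜ)), ?_, ?_, ?_⟩
  · simp only [Measure.map_add _ _ measurable_fst, Measure.map_smul, Measure.map_fst_prod,
      Measure.restrict_apply_univ, smul_smul]
    rw [← add_smul, hfst, hcancel', one_smul, one_smul, Measure.restrict_add_restrict_compl hA]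
  · simp only [Measure.map_add _ _ measurable_snd, Measure.map_smul, Measure.map_snd_prod,
      Measure.restrict_apply_univ, smul_smul]
    rw [add_left_comm, ← add_smul, hsnd, hcancel, one_smul, one_smul,
      Measure.restrict_add_restrict_compl hA']
  · simp [Measure.prod_prod, Measure.restrict_apply hA, Measure.restrict_apply hA']
end

section
/- Let X and X′ be measurable spaces and η, η′ finite measures on X, X′ respectively with η(X) = η′(X′). Let A_j ⊂ C_j ⊂ X and A′_j ⊂ C′_j ⊂ X′, j = 1,…,k, be measurable sets such that: (1) η(C_j) < η(X ∖ C_j) and η′(C′_j) < η′(X′ ∖ C′_j) for 1 ≤ j ≤ k; and (2) the sets A_j × (X′ ∖ C′_j) and (X ∖ C_j) × A′_j are disjoint from A_i × A′_i for all 1 ≤ i < j ≤ k. Then there exists a coupling η̃ of η and η′ such that η̃(A_j × A′_j) = 0 for every j = 1,…,k. -/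
open MeasureTheory

namespace MeasureTheory.Measure

variable {X X' : Type*} [MeasurableSpace X] [MeasurableSpace X']

theorem fst_smul (c : ENNReal) (μ : Measure (X × X')) : (c • μ).fst = c • μ.fst :=
  Measure.map_smul _ _ _

theorem snd_smul (c : ENNReal) (μ : Measure (X × X')) : (c • μ).snd = c • μ.snd :=
  Measure.map_smul _ _ _

/-- The normalized product measure is a coupling of two finite measures of equal mass. -/
theorem exists_coupling (η : Measure X) (η' : Measure X') [IsFiniteMeasure η]
    [IsFiniteMeasure η'] (hmass : η Set.univ = η' Set.univ) :
    ∃ μ : Measure (X × X'), μ.fst = η ∧ μ.snd = η' := by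
  by_cases h0 : η Set.univ = 0
  · have h := measure_univ_eq_zero.1 h0
    have h' := measure_univ_eq_zero.1 (hmass ▸ h0)
    exact ⟨0, by simp [h], by simp [h']⟩
  · refine ⟨(η Set.univ)⁻¹ • η.prod η', ?_, ?_⟩
    · rw [fst_smul, fst, map_fst_prod, smul_smul, ← hmass,
        ENNReal.inv_mul_cancel h0 (measure_ne_top _ _), one_smul]
    · rw [snd_smul, snd, map_snd_prod, smul_smul,
        ENNReal.inv_mul_cancel h0 (measure_ne_top _ _), one_smul]

/-- A product set disjoint from `A × A'` is null for the product of the marginals of measures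
concentrated on `A × X'` and on `X × A'`. -/
theorem fst_prod_snd_apply_eq_zero {ρ ξ : Measure (X × X')} [IsFiniteMeasure ρ]
    [IsFiniteMeasure ξ] {A : Set X} {A' : Set X'}
    (hA : ρ.fst Aᶜ = 0) (hA' : ξ.snd A'ᶜ = 0) {E : Set (X × X')}
    (hE : Disjoint (A ×ˢ A') E) : (ρ.fst.prod ξ.snd) E = 0 := by
  have hsub : E ⊆ Aᶜ ×ˢ Set.univ ∪ Set.univ ×ˢ A'ᶜ := by
    rintro ⟨x, y⟩ hp
    have := fun h => Set.disjoint_left.1 hE h hp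
    simp only [Set.mem_prod, Set.mem_union, Set.mem_compl_iff, Set.mem_univ] at *
    tauto
  refine measure_mono_null hsub (measure_union_null ?_ ?_) <;> simp [prod_prod, hA, hA']

theorem add_smul_add_inv_smul {M m : ENNReal} (hM : M ≠ 0) (hMtop : M ≠ ⊤) (hle : m ≤ M)
    (a b c : Measure X) :
    a + (M⁻¹ * (M - m)) • c + M⁻¹ • (M • b + m • c) = a + (b + c) := by
  have hcoef : M⁻¹ * (M - m) + M⁻¹ * m = 1 := by
    rw [← mul_add, tsub_add_cancel_of_le hle, ENNReal.inv_mul_cancel hM hMtop]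
  rw [smul_add, smul_smul, smul_smul, ENNReal.inv_mul_cancel hM hMtop, one_smul, add_assoc,
    add_left_comm (_ • c) b, ← add_smul, hcoef, one_smul]

/-- Exchange of mass: the mass on `A × A'` is swapped with mass on `B × B'`, so that it moves to
`A × B'` and `B × A'`, without changing the marginals. -/
theorem exists_exchange (μ : Measure (X × X')) [IsFiniteMeasure μ] {A B : Set X}
    {A' B' : Set X'} (hA : MeasurableSet A) (hB : MeasurableSet B) (hA' : MeasurableSet A')
    (hB' : MeasurableSet B') (hAB : Disjoint A B) (hAB' : Disjoint A' B')
    (hle : μ (A ×ˢ A') ≤ μ (B ×ˢ B')) :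
    ∃ ν : Measure (X × X'), ν.fst = μ.fst ∧ ν.snd = μ.snd ∧ ν (A ×ˢ A') = 0 ∧
      ∀ E, Disjoint (A ×ˢ B') E → Disjoint (B ×ˢ A') E → μ E = 0 → ν E = 0 := by
  by_cases hm : μ (A ×ˢ A') = 0
  · exact ⟨μ, rfl, rfl, hm, fun _ _ _ h => h⟩
  have hM : μ (B ×ˢ B') ≠ 0 := fun h => hm (le_antisymm (h ▸ hle) zero_le)
  have hMtop : μ (B ×ˢ B') ≠ ⊤ := measure_ne_top _ _
  have hS : MeasurableSet (A ×ˢ A') := hA.prod hA'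
  have hD : MeasurableSet (B ×ˢ B') := hB.prod hB'
  have hSD : Disjoint (A ×ˢ A') (B ×ˢ B') := Set.disjoint_prod.2 (Or.inl hAB)
  set S := A ×ˢ A'
  set D := B ×ˢ B'
  set σ := μ.restrict S with hσ
  set δ := μ.restrict D with hδ
  set τ := μ.restrict (S ∪ D)ᶜ with hτ
  have hμ : μ = τ + (σ + δ) := by
    rw [hσ, hδ, hτ, ← restrict_union hSD hD, add_comm, restrict_add_restrict_compl (hS.union hD)]
  have hσu : σ Set.univ = μ S := by simp [hσ]
  have hδu : δ Set.univ = μ D := by simp [hδ]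
  have hσA : σ.fst Aᶜ = 0 := by
    rw [fst_apply hA.compl, hσ, restrict_apply (measurable_fst hA.compl)]
    convert measure_empty (μ := μ)
    ext p; simp [S]; tauto
  have hσA' : σ.snd A'ᶜ = 0 := by
    rw [snd_apply hA'.compl, hσ, restrict_apply (measurable_snd hA'.compl)]
    convert measure_empty (μ := μ)
    ext p; simp [S]; tauto
  have hδB : δ.fst Bᶜ = 0 := by
    rw [fst_apply hB.compl, hδ, restrict_apply (measurable_fst hB.compl)]
    convert measure_empty (μ := μ)
    ext p; simp [D]; tauto
  have hδB' : δ.snd B'ᶜ = 0 := by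
    rw [snd_apply hB'.compl, hδ, restrict_apply (measurable_snd hB'.compl)]
    convert measure_empty (μ := μ)
    ext p; simp [D]; tauto
  have hnull (E : Set (X × X')) (h₁ : Disjoint (A ×ˢ B') E) (h₂ : Disjoint (B ×ˢ A') E)
      (hτE : τ E = 0) (hδE : δ E = 0) :
      (τ + ((μ D)⁻¹ * (μ D - μ S)) • δ +
        (μ D)⁻¹ • (σ.fst.prod δ.snd + δ.fst.prod σ.snd)) E = 0 := by
    simp [hτE, hδE, fst_prod_snd_apply_eq_zero hσA hδB' h₁,
      fst_prod_snd_apply_eq_zero hδB hσA' h₂]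
  refine ⟨_, ?_, ?_, hnull S ?_ ?_ ?_ ?_, fun E h₁ h₂ hE => hnull E h₁ h₂ ?_ ?_⟩
  · conv_rhs => rw [hμ]
    have hp (a : Measure X) (b : Measure X') [SFinite b] : (a.prod b).fst = b Set.univ • a :=
      map_fst_prod
    simp only [fst_add, fst_smul, hp, snd_univ, hσu, hδu]
    exact add_smul_add_inv_smul hM hMtop hle _ _ _
  · conv_rhs => rw [hμ]
    have hp (a : Measure X) (b : Measure X') [SFinite a] [SFinite b] :
        (a.prod b).snd = a Set.univ • b := map_snd_prod
    simp only [snd_add, snd_smul, hp, fst_univ, hσu, hδu]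
    rw [add_comm (μ S • δ.snd) (μ D • σ.snd)]
    exact add_smul_add_inv_smul hM hMtop hle _ _ _
  · exact Set.disjoint_prod.2 (Or.inr hAB'.symm)
  · exact Set.disjoint_prod.2 (Or.inl hAB.symm)
  · rw [hτ, restrict_apply hS]
    convert measure_empty (μ := μ)
    ext p; simp; tauto
  · rw [hδ, restrict_apply hS, hSD.inter_eq, measure_empty]
  · exact le_antisymm (hE ▸ restrict_apply_le _ _) zero_le
  · exact le_antisymm (hE ▸ restrict_apply_le _ _) zero_le

/-- If `C` and `C'` each carry less than half of the mass of a coupling, then the mass of `C × C'`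
is at most that of `Cᶜ × C'ᶜ`. -/
theorem prod_le_compl_prod_compl (μ : Measure (X × X')) [IsFiniteMeasure μ] {C : Set X}
    {C' : Set X'} (hC : MeasurableSet C) (hC' : MeasurableSet C')
    (h : μ.fst C ≤ μ.fst Cᶜ) (h' : μ.snd C' ≤ μ.snd C'ᶜ) :
    μ (C ×ˢ C') ≤ μ (Cᶜ ×ˢ C'ᶜ) := by
  have hfst (T : Set X) (hT : MeasurableSet T) :
      μ.fst T = μ (T ×ˢ C') + μ (T ×ˢ C'ᶜ) := by
    rw [fst_apply hT, ← measure_inter_add_sdiff _ (measurable_snd hC')]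
    rfl
  have hsnd (T : Set X') (hT : MeasurableSet T) :
      μ.snd T = μ (C ×ˢ T) + μ (Cᶜ ×ˢ T) := by
    rw [snd_apply hT, ← measure_inter_add_sdiff _ (measurable_fst hC)]
    congr 2 <;> ext p <;> simp [and_comm]
  rw [hfst C hC, hfst Cᶜ hC.compl] at h
  rw [hsnd C' hC', hsnd C'ᶜ hC'.compl] at h'
  have h₁ := measure_ne_top μ (C ×ˢ C')
  have h₂ := measure_ne_top μ (C ×ˢ C'ᶜ)
  have h₃ := measure_ne_top μ (Cᶜ ×ˢ C')
  have h₄ := measure_ne_top μ (Cᶜ ×ˢ C'ᶜ)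
  lift μ (C ×ˢ C') to NNReal using h₁ with a
  lift μ (C ×ˢ C'ᶜ) to NNReal using h₂ with b
  lift μ (Cᶜ ×ˢ C') to NNReal using h₃ with c
  lift μ (Cᶜ ×ˢ C'ᶜ) to NNReal using h₄ with d
  norm_cast at *
  rw [← NNReal.coe_le_coe] at *
  push_cast at *
  linarith

end MeasureTheory.Measure

/-- Lemma 6.2: given finite measures `η`, `η′` of equal total mass and measurable sets
`A j ⊆ C j ⊆ X`, `A' j ⊆ C' j ⊆ X′` for `j = 1, …, k` such that
(1) `η (C j) < η (X ∖ C j)` and `η' (C' j) < η' (X′ ∖ C' j)`, and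
(2) `A j × (X′ ∖ C' j)` and `(X ∖ C j) × A' j` are disjoint from `A i × A' i` for `i < j`,
there is a coupling `η̃` of `η` and `η′` with `η̃ (A j × A' j) = 0` for every `j`. -/
theorem stmt10 {X X' : Type*} [MeasurableSpace X] [MeasurableSpace X']
    (η : Measure X) (η' : Measure X') [IsFiniteMeasure η] [IsFiniteMeasure η']
    (hmass : η Set.univ = η' Set.univ) (k : ℕ)
    (A C : Fin k → Set X) (A' C' : Fin k → Set X')
    (hAmeas : ∀ j, MeasurableSet (A j)) (hCmeas : ∀ j, MeasurableSet (C j))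
    (hA'meas : ∀ j, MeasurableSet (A' j)) (hC'meas : ∀ j, MeasurableSet (C' j))
    (hAC : ∀ j, A j ⊆ C j) (hA'C' : ∀ j, A' j ⊆ C' j)
    (h1 : ∀ j, η (C j) < η (C j)ᶜ) (h1' : ∀ j, η' (C' j) < η' (C' j)ᶜ)
    (h2 : ∀ i j, i < j → Disjoint (A j ×ˢ (C' j)ᶜ) (A i ×ˢ A' i) ∧
      Disjoint ((C j)ᶜ ×ˢ A' j) (A i ×ˢ A' i)) :
    ∃ ητ : Measure (X × X'), ητ.map Prod.fst = η ∧ ητ.map Prod.snd = η' ∧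
      ∀ j, ητ (A j ×ˢ A' j) = 0 := by
  suffices H : ∀ n : ℕ, ∃ μ : Measure (X × X'), μ.fst = η ∧ μ.snd = η' ∧
      ∀ j : Fin k, (j : ℕ) < n → μ (A j ×ˢ A' j) = 0 by
    obtain ⟨μ, h, h', hμ⟩ := H k
    exact ⟨μ, h, h', fun j => hμ j j.isLt⟩
  intro n
  induction n with
  | zero =>
    obtain ⟨μ, h, h'⟩ := Measure.exists_coupling η η' hmass
    exact ⟨μ, h, h', fun j hj => absurd hj (Nat.not_lt_zero _)⟩
  | succ n ih =>
    obtain ⟨μ, h, h', hμ⟩ := ih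
    by_cases hn : n < k
    · set m : Fin k := ⟨n, hn⟩
      have : IsFiniteMeasure μ := ⟨by rw [← Measure.fst_univ, h]; exact measure_lt_top _ _⟩
      have hle : μ (A m ×ˢ A' m) ≤ μ ((C m)ᶜ ×ˢ (C' m)ᶜ) :=
        (measure_mono (Set.prod_mono (hAC m) (hA'C' m))).trans
          (μ.prod_le_compl_prod_compl (hCmeas m) (hC'meas m) (h ▸ (h1 m).le) (h' ▸ (h1' m).le))
      obtain ⟨ν, hν, hν', hν0, hνE⟩ := μ.exists_exchange (hAmeas m) (hCmeas m).compl
        (hA'meas m) (hC'meas m).compl (Set.disjoint_compl_right_iff_subset.2 (hAC m))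
        (Set.disjoint_compl_right_iff_subset.2 (hA'C' m)) hle
      refine ⟨ν, hν.trans h, hν'.trans h', fun j hj => ?_⟩
      rcases Nat.lt_succ_iff_lt_or_eq.1 hj with hj | hj
      · exact hνE _ (h2 j m hj).1 (h2 j m hj).2 (hμ j hj)
      · rwa [show j = m from Fin.ext hj]
    · exact ⟨μ, h, h', fun j _ => hμ j (by omega)⟩
end

section
/- Let X and X′ be compact metric spaces and η, η′ finite Borel measures on X, X′ respectively with η(X) = η′(X′). Let K be a compact subset of X × X′ and, for x ∈ X and x′ ∈ X′, set K(x′) = {y ∈ X : (y,x′) ∈ K} and K′(x) = {y′ ∈ X′ : (x,y′) ∈ K}. If η(K(x′)) < η(X ∖ K(x′)) and η′(K′(x)) < η′(X′ ∖ K′(x)) for every (x,x′) ∈ X × X′, then there exists a coupling η̃ of η and η′ that vanishes on an open neighborhood of K. -/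
open MeasureTheory Filter Topology
open scoped ENNReal

section Avoiding

variable {X X' : Type*} [MeasurableSpace X] [MeasurableSpace X']

lemma smul_le_self_of_le_one {c : ℝ≥0∞} (μ : Measure X) (h : c ≤ 1) : c • μ ≤ μ :=
  Measure.le_iff.2 fun s _ ↦ by simpa using mul_le_mul_left h (μ s)

/-- A coupling `plan` of parts of `η` and `η'` that vanishes on `U`, together with the unmatched
parts `restFst` and `restSnd` of the two measures. -/
structure AvoidingSubcoupling (η : Measure X) (η' : Measure X') (U : Set (X × X')) where
  plan : Measure (X × X')
  restFst : Measure X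
  restSnd : Measure X'
  map_fst_add : plan.map Prod.fst + restFst = η
  map_snd_add : plan.map Prod.snd + restSnd = η'
  plan_null : plan U = 0

namespace AvoidingSubcoupling

variable {η : Measure X} {η' : Measure X'} {U : Set (X × X')}

lemma plan_univ_add (S : AvoidingSubcoupling η η' U) :
    S.plan Set.univ + S.restFst Set.univ = η Set.univ := by
  conv_rhs => rw [← S.map_fst_add]
  simp [Measure.map_apply measurable_fst MeasurableSet.univ]

lemma plan_univ_add' (S : AvoidingSubcoupling η η' U) :
    S.plan Set.univ + S.restSnd Set.univ = η' Set.univ := by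
  conv_rhs => rw [← S.map_snd_add]
  simp [Measure.map_apply measurable_snd MeasurableSet.univ]

instance [IsFiniteMeasure η] (S : AvoidingSubcoupling η η' U) : IsFiniteMeasure S.plan :=
  ⟨(le_self_add.trans_eq S.plan_univ_add).trans_lt (measure_lt_top η _)⟩

instance [IsFiniteMeasure η] (S : AvoidingSubcoupling η η' U) : IsFiniteMeasure S.restFst :=
  ⟨(le_add_self.trans_eq S.plan_univ_add).trans_lt (measure_lt_top η _)⟩

instance [IsFiniteMeasure η'] (S : AvoidingSubcoupling η η' U) : IsFiniteMeasure S.restSnd :=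
  ⟨(le_add_self.trans_eq S.plan_univ_add').trans_lt (measure_lt_top η' _)⟩

lemma rest_univ_eq [IsFiniteMeasure η] (hm : η Set.univ = η' Set.univ)
    (S : AvoidingSubcoupling η η' U) : S.restSnd Set.univ = S.restFst Set.univ := by
  have h := S.plan_univ_add.trans (hm.trans S.plan_univ_add'.symm)
  exact ((ENNReal.add_right_inj (measure_ne_top _ _)).1 h).symm

/-- Replace the part `a` of the plan by `b`, using up the parts `p` and `p'` of the rests. -/
lemma exists_exchange [IsFiniteMeasure η] [IsFiniteMeasure η'] (S : AvoidingSubcoupling η η' U)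
    {a b : Measure (X × X')} {p : Measure X} {p' : Measure X'} (ha : a ≤ S.plan)
    (hp : p ≤ S.restFst) (hp' : p' ≤ S.restSnd) (hb : b U = 0)
    (hfst : b.map Prod.fst = a.map Prod.fst + p) (hsnd : b.map Prod.snd = a.map Prod.snd + p') :
    ∃ T : AvoidingSubcoupling η η' U, T.plan + a = S.plan + b ∧ T.restFst + p = S.restFst := by
  have := isFiniteMeasure_of_le _ ha
  have := isFiniteMeasure_of_le _ hp
  have := isFiniteMeasure_of_le _ hp'
  have ea := Measure.sub_add_cancel_of_le ha
  have ep := Measure.sub_add_cancel_of_le hp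
  have ep' := Measure.sub_add_cancel_of_le hp'
  refine ⟨⟨S.plan - a + b, S.restFst - p, S.restSnd - p', ?_, ?_, ?_⟩, ?_, ep⟩
  · conv_rhs => rw [← S.map_fst_add, ← ep, ← ea]
    rw [Measure.map_add _ _ measurable_fst, Measure.map_add _ _ measurable_fst, hfst]
    ac_rfl
  · conv_rhs => rw [← S.map_snd_add, ← ep', ← ea]
    rw [Measure.map_add _ _ measurable_snd, Measure.map_add _ _ measurable_snd, hsnd]
    ac_rfl
  · rw [Measure.add_apply, hb, add_zero]
    exact le_antisymm ((Measure.sub_le U).trans_eq S.plan_null) zero_le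
  · conv_rhs => rw [← ea]
    ac_rfl

/-- Match a part of the product of the rests directly. -/
lemma exists_direct [IsFiniteMeasure η] [IsFiniteMeasure η'] (hm : η Set.univ = η' Set.univ)
    (hU : MeasurableSet U) (S : AvoidingSubcoupling η η' U) (h0 : S.restFst Set.univ ≠ 0) :
    ∃ (T : AvoidingSubcoupling η η' U) (b : Measure (X × X')),
      T.plan = S.plan + b ∧ b U = 0 ∧
      T.restFst Set.univ + b Set.univ = S.restFst Set.univ ∧
      b Set.univ = (S.restFst Set.univ)⁻¹ * (S.restFst.prod S.restSnd) Uᶜ := by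
  set δ := S.restFst Set.univ with hδ
  have hδt : δ ≠ ∞ := measure_ne_top _ _
  set b := δ⁻¹ • (S.restFst.prod S.restSnd).restrict Uᶜ with hb
  have hbU : b U = 0 := by simp [hb, Measure.restrict_apply hU]
  have hle : b ≤ δ⁻¹ • (S.restFst.prod S.restSnd) := by
    rw [hb]; gcongr; exact Measure.restrict_le_self
  have hp : b.map Prod.fst ≤ S.restFst := by
    refine (Measure.map_mono hle measurable_fst).trans_eq ?_
    rw [Measure.map_smul, Measure.map_fst_prod, S.rest_univ_eq hm, smul_smul,
      ENNReal.inv_mul_cancel h0 hδt, one_smul]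
  have hp' : b.map Prod.snd ≤ S.restSnd := by
    refine (Measure.map_mono hle measurable_snd).trans_eq ?_
    rw [Measure.map_smul, Measure.map_snd_prod, smul_smul,
      ENNReal.inv_mul_cancel h0 hδt, one_smul]
  obtain ⟨T, hT, hT'⟩ := S.exists_exchange (a := 0) (Measure.zero_le _) hp hp' hbU (by simp)
    (by simp)
  refine ⟨T, b, by simpa using hT, hbU, ?_, by simp [hb]⟩
  rw [hδ, ← hT', Measure.add_apply, Measure.map_apply measurable_fst MeasurableSet.univ,
    Set.preimage_univ]

/-- The pairs `((x, x'), (y, y'))` for which `(y, y')` can be replaced by `(x, y')` and `(y, x')`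
outside `U`. -/
def swappable (U : Set (X × X')) : Set ((X × X') × (X × X')) :=
  {q | (q.1.1, q.2.2) ∉ U ∧ (q.2.1, q.1.2) ∉ U}

lemma measurableSet_swappable (hU : MeasurableSet U) : MeasurableSet (swappable U) :=
  ((show Measurable fun q : (X × X') × (X × X') ↦ (q.1.1, q.2.2) by fun_prop) hU.compl).inter
    ((show Measurable fun q : (X × X') × (X × X') ↦ (q.2.1, q.1.2) by fun_prop) hU.compl)

/-- Match a part of the rests along augmenting paths of length three. -/
lemma exists_augment [IsFiniteMeasure η] [IsFiniteMeasure η'] (hm : η Set.univ = η' Set.univ)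
    (hU : MeasurableSet U) (S : AvoidingSubcoupling η η' U) (h0 : S.restFst Set.univ ≠ 0) :
    ∃ (T : AvoidingSubcoupling η η' U) (a b : Measure (X × X')) (g : ℝ≥0∞),
      T.plan + a = S.plan + b ∧ b U = 0 ∧ a Set.univ = g ∧ b Set.univ = 2 * g ∧
      T.restFst Set.univ + g = S.restFst Set.univ ∧
      g = (S.restFst Set.univ * η Set.univ)⁻¹ *
        ((S.restFst.prod S.restSnd).prod S.plan) (swappable U) := by
  set δ := S.restFst Set.univ with hδ
  have hδ' : S.restSnd Set.univ = δ := S.rest_univ_eq hm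
  have hδt : δ ≠ ∞ := measure_ne_top _ _
  set m := η Set.univ with hmdef
  have hmt : m ≠ ∞ := measure_ne_top _ _
  have hsum : S.plan Set.univ + δ = m := S.plan_univ_add
  have hm0 : m ≠ 0 := fun h ↦ h0 (add_eq_zero.1 (hsum.trans h)).2
  have hc : (δ * m)⁻¹ * δ = m⁻¹ := by
    rw [ENNReal.mul_inv (Or.inl h0) (Or.inl hδt), mul_right_comm,
      ENNReal.inv_mul_cancel h0 hδt, one_mul]
  have hcδ : m⁻¹ * δ ≤ 1 := by
    rw [← ENNReal.inv_mul_cancel hm0 hmt]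
    gcongr
    exact le_add_self.trans_eq hsum
  have hcγ : m⁻¹ * S.plan Set.univ ≤ 1 := by
    rw [← ENNReal.inv_mul_cancel hm0 hmt]
    gcongr
    exact le_self_add.trans_eq hsum
  set R := (δ * m)⁻¹ • ((S.restFst.prod S.restSnd).prod S.plan) with hR
  set q := (δ * m)⁻¹ • ((S.restFst.prod S.restSnd).prod S.plan).restrict (swappable U) with hq
  have hle : q ≤ R := by
    rw [hq, hR]; gcongr; exact Measure.restrict_le_self
  have hqc : q (swappable U)ᶜ = 0 := by
    simp [hq, Measure.restrict_apply (measurableSet_swappable hU).compl]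
  have hR1 : R.map Prod.fst ≤ (m⁻¹ * S.plan Set.univ * δ⁻¹) • S.restFst.prod S.restSnd := by
    rw [hR, Measure.map_smul, Measure.map_fst_prod, smul_smul,
      ENNReal.mul_inv (Or.inl h0) (Or.inl hδt)]
    apply le_of_eq; congr 1; ring
  have ha : q.map Prod.snd ≤ S.plan := by
    refine (Measure.map_mono hle measurable_snd).trans ?_
    rw [hR, Measure.map_smul, Measure.map_snd_prod, smul_smul, ← Set.univ_prod_univ,
      Measure.prod_prod, hδ', ← hδ, ← mul_assoc, hc]
    exact smul_le_self_of_le_one _ hcδ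
  have hp : q.map (fun z ↦ z.1.1) ≤ S.restFst := by
    change q.map (Prod.fst ∘ Prod.fst) ≤ _
    rw [← Measure.map_map measurable_fst measurable_fst]
    refine (Measure.map_mono ((Measure.map_mono hle measurable_fst).trans hR1)
      measurable_fst).trans ?_
    rw [Measure.map_smul, Measure.map_fst_prod, smul_smul, hδ', mul_assoc,
      ENNReal.inv_mul_cancel h0 hδt, mul_one]
    exact smul_le_self_of_le_one _ hcγ
  have hp' : q.map (fun z ↦ z.1.2) ≤ S.restSnd := by
    change q.map (Prod.snd ∘ Prod.fst) ≤ _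
    rw [← Measure.map_map measurable_snd measurable_fst]
    refine (Measure.map_mono ((Measure.map_mono hle measurable_fst).trans hR1)
      measurable_snd).trans ?_
    rw [Measure.map_smul, Measure.map_snd_prod, smul_smul, ← hδ, mul_assoc,
      ENNReal.inv_mul_cancel h0 hδt, mul_one]
    exact smul_le_self_of_le_one _ hcγ
  have m1 : Measurable fun z : (X × X') × (X × X') ↦ (z.1.1, z.2.2) := by fun_prop
  have m2 : Measurable fun z : (X × X') × (X × X') ↦ (z.2.1, z.1.2) := by fun_prop
  have hbU : (q.map (fun z ↦ (z.1.1, z.2.2)) + q.map (fun z ↦ (z.2.1, z.1.2))) U = 0 := by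
    rw [Measure.add_apply, Measure.map_apply m1 hU, Measure.map_apply m2 hU,
      measure_mono_null _ hqc, measure_mono_null _ hqc, add_zero]
    · exact fun z hz h ↦ h.2 hz
    · exact fun z hz h ↦ h.1 hz
  obtain ⟨T, hT, hT'⟩ := S.exists_exchange ha hp hp' hbU
    (by
      rw [Measure.map_add _ _ measurable_fst, Measure.map_map measurable_fst m1,
        Measure.map_map measurable_fst m2, Measure.map_map measurable_fst measurable_snd, add_comm]
      rfl)
    (by
      rw [Measure.map_add _ _ measurable_snd, Measure.map_map measurable_snd m1,
        Measure.map_map measurable_snd m2, Measure.map_map measurable_snd measurable_snd]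
      rfl)
  refine ⟨T, _, _, q Set.univ, hT, hbU, ?_, ?_, ?_, by simp [hq]⟩
  · rw [Measure.map_apply measurable_snd MeasurableSet.univ, Set.preimage_univ]
  · rw [Measure.add_apply, Measure.map_apply m1 MeasurableSet.univ,
      Measure.map_apply m2 MeasurableSet.univ, Set.preimage_univ, Set.preimage_univ, two_mul]
  · rw [hδ, ← hT', Measure.add_apply, Measure.map_apply (by fun_prop) MeasurableSet.univ,
      Set.preimage_univ]

/-- If every slice of `U` has measure at most `h`, then either a direct matching or an augmentation
makes definite progress. -/
lemma half_le_or_le_swappable [IsFiniteMeasure η] [IsFiniteMeasure η']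
    (hm : η Set.univ = η' Set.univ) (hU : MeasurableSet U) (S : AvoidingSubcoupling η η' U)
    {h : ℝ≥0∞} (h1 : ∀ x', η {x | (x, x') ∈ U} ≤ h) (h2 : ∀ x, η' {x' | (x, x') ∈ U} ≤ h)
    (hh : 2 * h < η Set.univ) :
    S.restFst Set.univ ^ 2 ≤ 2 * (S.restFst.prod S.restSnd) Uᶜ ∨
      S.restFst Set.univ ^ 2 * η Set.univ ≤
        ((S.restFst.prod S.restSnd).prod S.plan) (swappable U) +
          S.restFst Set.univ ^ 2 * (2 * h) := by
  set δ := S.restFst Set.univ with hδ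
  have hδ' : S.restSnd Set.univ = δ := S.rest_univ_eq hm
  set P := S.restFst.prod S.restSnd with hP
  have m1 : Measurable fun z : (X × X') × (X × X') ↦ (z.1.1, z.2.2) := by fun_prop
  have m2 : Measurable fun z : (X × X') × (X × X') ↦ (z.2.1, z.1.2) := by fun_prop
  have b1 : (P.prod S.plan) {z | (z.1.1, z.2.2) ∈ U} + δ * P U ≤ δ * (h * δ) := by
    have e : (P.prod S.plan).map (fun z ↦ (z.1.1, z.2.2)) =
        δ • S.restFst.prod (S.plan.map Prod.snd) := by
      have := Measure.map_prod_map P S.plan measurable_fst measurable_snd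
      rw [hP, Measure.map_fst_prod, Measure.prod_smul_left, hδ', ← hP] at this
      exact this.symm
    have e' : (P.prod S.plan) {z | (z.1.1, z.2.2) ∈ U} =
        δ * S.restFst.prod (S.plan.map Prod.snd) U := by
      exact (Measure.map_apply m1 hU).symm.trans (by rw [e]; simp)
    rw [e', hP, ← mul_add, ← Measure.add_apply, ← Measure.prod_add, S.map_snd_add,
      Measure.prod_apply hU]
    gcongr
    exact (lintegral_mono h2).trans_eq (by simp [hδ])
  have b2 : (P.prod S.plan) {z | (z.2.1, z.1.2) ∈ U} + δ * P U ≤ δ * (h * δ) := by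
    have e : (P.prod S.plan).map (fun z ↦ (z.2.1, z.1.2)) =
        δ • (S.plan.map Prod.fst).prod S.restSnd := by
      have := Measure.map_prod_map P S.plan measurable_snd measurable_fst
      rw [hP, Measure.map_snd_prod, Measure.prod_smul_left, ← hδ, ← hP] at this
      rw [← Measure.prod_swap (μ := S.restSnd), ← Measure.map_smul, this,
        Measure.map_map measurable_swap (by fun_prop)]
      rfl
    have e' : (P.prod S.plan) {z | (z.2.1, z.1.2) ∈ U} =
        δ * (S.plan.map Prod.fst).prod S.restSnd U := by
      exact (Measure.map_apply m2 hU).symm.trans (by rw [e]; simp)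
    rw [e', hP, ← mul_add, ← Measure.add_apply, ← Measure.add_prod, S.map_fst_add,
      Measure.prod_apply_symm hU]
    gcongr
    exact (lintegral_mono h1).trans_eq (by simp [hδ'])
  have hc : (P.prod S.plan) Set.univ ≤ (P.prod S.plan) (swappable U) +
      ((P.prod S.plan) {z | (z.1.1, z.2.2) ∈ U} + (P.prod S.plan) {z | (z.2.1, z.1.2) ∈ U}) := by
    refine le_trans ?_ ((measure_union_le _ _).trans (add_le_add_right (measure_union_le _ _) _))
    refine measure_mono fun z _ ↦ ?_
    simp only [swappable, Set.mem_union, Set.mem_ofPred_eq]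
    tauto
  have hQ : (P.prod S.plan) Set.univ = δ * δ * S.plan Set.univ := by
    rw [← Set.univ_prod_univ, Measure.prod_prod, hP, ← Set.univ_prod_univ, Measure.prod_prod, hδ']
  have hPs : P U + P Uᶜ = δ * δ := by
    rw [measure_add_measure_compl hU, hP, ← Set.univ_prod_univ, Measure.prod_prod, hδ']
  have hsum : S.plan Set.univ + δ = η Set.univ := S.plan_univ_add
  rw [hQ] at hc
  rw [← hsum] at hh ⊢
  have ht : h ≠ ∞ := by
    rintro rfl
    simp at hh
  have t1 : δ ≠ ∞ := measure_ne_top _ _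
  have t2 : P U ≠ ∞ := measure_ne_top _ _
  have t3 : P Uᶜ ≠ ∞ := measure_ne_top _ _
  have t4 : S.plan Set.univ ≠ ∞ := measure_ne_top _ _
  have t5 : (P.prod S.plan) (swappable U) ≠ ∞ := measure_ne_top _ _
  have t6 : (P.prod S.plan) {z | (z.1.1, z.2.2) ∈ U} ≠ ∞ := measure_ne_top _ _
  have t7 : (P.prod S.plan) {z | (z.2.1, z.1.2) ∈ U} ≠ ∞ := measure_ne_top _ _
  generalize P U = E at *
  generalize P Uᶜ = D at *
  generalize S.plan Set.univ = w at *
  generalize (P.prod S.plan) (swappable U) = G at *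
  generalize (P.prod S.plan) {z | (z.1.1, z.2.2) ∈ U} = Q₁ at *
  generalize (P.prod S.plan) {z | (z.2.1, z.1.2) ∈ U} = Q₂ at *
  clear_value δ
  lift δ to NNReal using t1
  lift E to NNReal using t2
  lift D to NNReal using t3
  lift w to NNReal using t4
  lift G to NNReal using t5
  lift Q₁ to NNReal using t6
  lift Q₂ to NNReal using t7
  lift h to NNReal using ht
  norm_cast at *
  simp only [← NNReal.coe_le_coe, ← NNReal.coe_lt_coe, ← NNReal.coe_inj] at *
  push_cast at *
  by_contra! hcon
  nlinarith [mul_nonneg δ.coe_nonneg (sub_nonneg.2 hcon.1.le)]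

lemma exists_contraction [IsFiniteMeasure η] [IsFiniteMeasure η']
    (hm : η Set.univ = η' Set.univ) (hU : MeasurableSet U)
    {h : ℝ≥0∞} (h1 : ∀ x', η {x | (x, x') ∈ U} ≤ h) (h2 : ∀ x, η' {x' | (x, x') ∈ U} ≤ h)
    (hh : 2 * h < η Set.univ) :
    ∃ r < (1 : ℝ≥0∞), ∀ S : AvoidingSubcoupling η η' U,
      ∃ (T : AvoidingSubcoupling η η' U) (a b : Measure (X × X')),
        T.plan + a = S.plan + b ∧ b U = 0 ∧ a Set.univ ≤ S.restFst Set.univ ∧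
        b Set.univ ≤ 2 * S.restFst Set.univ ∧
        T.restFst Set.univ ≤ r * S.restFst Set.univ := by
  have hm0 : η Set.univ ≠ 0 := hh.ne_bot
  have hmt : η Set.univ ≠ ∞ := measure_ne_top _ _
  refine ⟨max 2⁻¹ (2 * h / η Set.univ), max_lt ENNReal.one_half_lt_one ?_, fun S ↦ ?_⟩
  · rwa [ENNReal.div_lt_iff (Or.inl hm0) (Or.inl hmt), one_mul]
  by_cases h0 : S.restFst Set.univ = 0
  · exact ⟨S, 0, 0, rfl, by simp, by simp, by simp, by simp [h0]⟩
  have hδt : S.restFst Set.univ ≠ ∞ := measure_ne_top _ _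
  rcases S.half_le_or_le_swappable hm hU h1 h2 hh with hD | hG
  · obtain ⟨T, b, hT, hbU, hsum, hb⟩ := S.exists_direct hm hU h0
    have hbδ : b Set.univ ≤ S.restFst Set.univ := le_add_self.trans_eq hsum
    refine ⟨T, 0, b, by simpa using hT, hbU, by simp, ?_, ?_⟩
    · rw [two_mul]
      exact hbδ.trans le_self_add
    · refine le_trans ?_ (mul_le_mul_left (le_max_left _ _) _)
      have hgain : S.restFst Set.univ ≤ 2 * b Set.univ := by
        rw [hb, mul_left_comm]
        refine le_trans (le_of_eq ?_) (mul_le_mul_right hD _)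
        rw [sq, ← mul_assoc, ENNReal.inv_mul_cancel h0 hδt, one_mul]
      rw [← hsum, two_mul] at hgain
      have hTb := (ENNReal.add_le_add_iff_right (hbδ.trans_lt hδt.lt_top).ne).1 hgain
      rw [mul_comm, ← div_eq_mul_inv, ENNReal.le_div_iff_mul_le (by simp) (by simp), ← hsum,
        mul_two]
      gcongr
  · obtain ⟨T, a, b, g, hT, hbU, ha, hb, hsum, hg⟩ := S.exists_augment hm hU h0
    have hgδ : g ≤ S.restFst Set.univ := le_add_self.trans_eq hsum
    refine ⟨T, a, b, hT, hbU, ha.trans_le hgδ, by rw [hb]; gcongr, ?_⟩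
    refine le_trans ?_ (mul_le_mul_left (le_max_right _ _) _)
    have hinv : (S.restFst Set.univ * η Set.univ)⁻¹ * S.restFst Set.univ ^ 2 =
        S.restFst Set.univ * (η Set.univ)⁻¹ := by
      rw [ENNReal.mul_inv (Or.inl h0) (Or.inl hδt), sq, mul_right_comm, ← mul_assoc,
        ENNReal.inv_mul_cancel h0 hδt, one_mul]
    have hgain := mul_le_mul_right hG (S.restFst Set.univ * η Set.univ)⁻¹
    rw [mul_add, ← hg, ← mul_assoc, ← mul_assoc, hinv, mul_assoc,
      ENNReal.inv_mul_cancel hm0 hmt, mul_one] at hgain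
    nth_rw 1 [← hsum] at hgain
    rw [add_comm, ENNReal.add_le_add_iff_left (hgδ.trans_lt hδt.lt_top).ne] at hgain
    refine hgain.trans_eq ?_
    rw [div_eq_mul_inv]
    ring

end AvoidingSubcoupling

/-- A coupling avoiding `U` exists once every slice of `U` has uniformly less than half the mass. -/
theorem exists_coupling_null_of_slices_le {η : Measure X} {η' : Measure X'} {U : Set (X × X')}
    [IsFiniteMeasure η] [IsFiniteMeasure η']
    (hm : η Set.univ = η' Set.univ) (hU : MeasurableSet U)
    {h : ℝ≥0∞} (h1 : ∀ x', η {x | (x, x') ∈ U} ≤ h) (h2 : ∀ x, η' {x' | (x, x') ∈ U} ≤ h)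
    (hh : 2 * h < η Set.univ) :
    ∃ γ : Measure (X × X'), γ.map Prod.fst = η ∧ γ.map Prod.snd = η' ∧ γ U = 0 := by
  obtain ⟨r, hr, hstep⟩ := AvoidingSubcoupling.exists_contraction hm hU h1 h2 hh
  choose next a b hnext hbU ha hb hrest using hstep
  let S : ℕ → AvoidingSubcoupling η η' U := fun n ↦ next^[n] ⟨0, η, η', by simp, by simp, by simp⟩
  have hS : ∀ n, S (n + 1) = next (S n) := fun n ↦ Function.iterate_succ_apply' _ _ _
  have hdecay : ∀ n, (S n).restFst Set.univ ≤ r ^ n * η Set.univ := by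
    intro n
    induction n with
    | zero => simp [S]
    | succ n ih =>
      rw [hS, pow_succ', mul_assoc]
      exact (hrest _).trans (mul_le_mul_right ih r)
  have htend : Tendsto (fun n ↦ (S n).restFst Set.univ) atTop (𝓝 0) := by
    have := ENNReal.Tendsto.mul_const (b := η Set.univ)
      (ENNReal.tendsto_pow_atTop_nhds_zero_of_lt_one hr) (Or.inr (measure_ne_top η _))
    rw [zero_mul] at this
    exact tendsto_of_tendsto_of_tendsto_of_le_of_le tendsto_const_nhds this
      (fun _ ↦ zero_le) hdecay
  have hpartial : ∀ n, (S n).plan + ∑ k ∈ Finset.range n, a (S k) =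
      ∑ k ∈ Finset.range n, b (S k) := by
    intro n
    induction n with
    | zero => simp [S]
    | succ n ih =>
      rw [Finset.sum_range_succ, Finset.sum_range_succ, ← ih, hS,
        add_comm (∑ k ∈ Finset.range n, a (S k)), ← add_assoc, hnext]
      ac_rfl
  set A := Measure.sum fun n ↦ a (S n) with hA
  set B := Measure.sum fun n ↦ b (S n) with hB
  have hBfin : IsFiniteMeasure B := by
    refine ⟨?_⟩
    rw [hB, Measure.sum_apply _ MeasurableSet.univ]
    refine (ENNReal.tsum_le_tsum fun n ↦ (hb (S n)).trans
      (mul_le_mul_right (hdecay n) 2)).trans_lt ?_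
    rw [ENNReal.tsum_mul_left, ENNReal.tsum_mul_right, ENNReal.tsum_geometric]
    exact ENNReal.mul_lt_top (by simp) (ENNReal.mul_lt_top
      (ENNReal.inv_lt_top.2 (tsub_pos_of_lt hr)) (measure_lt_top _ _))
  have hAB : A ≤ B := by
    refine Measure.le_iff.2 fun s hs ↦ ?_
    rw [hA, hB, Measure.sum_apply _ hs, Measure.sum_apply _ hs]
    refine ENNReal.tsum_le_of_sum_range_le fun n ↦
      le_trans ?_ (ENNReal.sum_le_tsum (Finset.range n))
    rw [← Measure.finsetSum_apply, ← Measure.finsetSum_apply, ← hpartial n, Measure.add_apply]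
    exact le_add_self
  have hAfin : IsFiniteMeasure A := isFiniteMeasure_of_le _ hAB
  have hsub : B - A + A = B := Measure.sub_add_cancel_of_le hAB
  have key {t : Set (X × X')} (ht : MeasurableSet t) {c : ℝ≥0∞} {v : ℕ → ℝ≥0∞}
      (hv : Tendsto v atTop (𝓝 0)) (hadd : ∀ n, (S n).plan t + v n = c) : (B - A) t = c := by
    have hlim : B t = A t + c := by
      have tB := (ENNReal.tendsto_nat_tsum fun n ↦ b (S n) t).add hv
      have tA := (ENNReal.tendsto_nat_tsum fun n ↦ a (S n) t).add (tendsto_const_nhds (x := c))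
      rw [← Measure.sum_apply _ ht] at tA tB
      rw [add_zero] at tB
      refine tendsto_nhds_unique tB (tA.congr fun n ↦ ?_)
      rw [← Measure.finsetSum_apply, ← Measure.finsetSum_apply, ← hpartial n, ← hadd n,
        Measure.add_apply]
      ac_rfl
    rwa [← hsub, Measure.add_apply, add_comm,
      ENNReal.add_right_inj (measure_ne_top _ _)] at hlim
  have htend' : Tendsto (fun n ↦ (S n).restSnd Set.univ) atTop (𝓝 0) := by
    simpa only [AvoidingSubcoupling.rest_univ_eq hm] using htend
  refine ⟨B - A, ?_, ?_, ?_⟩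
  · ext s hs
    rw [Measure.map_apply measurable_fst hs]
    refine key (measurable_fst hs) (tendsto_of_tendsto_of_tendsto_of_le_of_le tendsto_const_nhds
      htend (fun _ ↦ zero_le) fun n ↦ measure_mono (Set.subset_univ s)) fun n ↦ ?_
    rw [← Measure.map_apply measurable_fst hs, ← Measure.add_apply, (S n).map_fst_add]
  · ext s hs
    rw [Measure.map_apply measurable_snd hs]
    refine key (measurable_snd hs) (tendsto_of_tendsto_of_tendsto_of_le_of_le tendsto_const_nhds
      htend' (fun _ ↦ zero_le) fun n ↦ measure_mono (Set.subset_univ s)) fun n ↦ ?_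
    rw [← Measure.map_apply measurable_snd hs, ← Measure.add_apply, (S n).map_snd_add]
  · refine le_antisymm ((Measure.sub_le U).trans_eq ?_) zero_le
    simp [hB, Measure.sum_apply _ hU, hbU]

end Avoiding

/-- If every slice of a compact set has measure below `c`, then the slices of some open
neighborhood have measure uniformly below `c`. -/
lemma exists_open_slices_le {X X' : Type*} [MetricSpace X] [CompactSpace X] [MetricSpace X']
    [CompactSpace X'] [MeasurableSpace X] [BorelSpace X] (η : Measure X) [IsFiniteMeasure η]
    {K : Set (X × X')} (hK : IsCompact K) {c : ℝ≥0∞} (hc : 0 < c)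
    (h : ∀ x', η {x | (x, x') ∈ K} < c) :
    ∃ U : Set (X × X'), IsOpen U ∧ K ⊆ U ∧ ∃ d < c, ∀ x', η {x | (x, x') ∈ U} ≤ d := by
  suffices ∃ U : Set (X × X'), IsOpen U ∧ K ⊆ U ∧ ∃ d < c, ∀ x' ∈ Set.univ,
      η {x | (x, x') ∈ U} ≤ d by simpa using this
  refine isCompact_univ.induction_on (p := fun S ↦ ∃ U : Set (X × X'), IsOpen U ∧ K ⊆ U ∧
    ∃ d < c, ∀ x' ∈ S, η {x | (x, x') ∈ U} ≤ d) ?_ ?_ ?_ ?_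
  · exact ⟨Set.univ, isOpen_univ, Set.subset_univ _, 0, hc, by simp⟩
  · rintro S T hST ⟨U, hU, hKU, d, hd, hs⟩
    exact ⟨U, hU, hKU, d, hd, fun x' hx' ↦ hs x' (hST hx')⟩
  · rintro S T ⟨U, hU, hKU, d, hd, hs⟩ ⟨V, hV, hKV, e, he, ht⟩
    refine ⟨U ∩ V, hU.inter hV, Set.subset_inter hKU hKV, max d e, max_lt hd he, ?_⟩
    rintro x' (hx' | hx')
    · exact (measure_mono fun x hx ↦ hx.1).trans ((hs x' hx').trans (le_max_left _ _))
    · exact (measure_mono fun x hx ↦ hx.2).trans ((ht x' hx').trans (le_max_right _ _))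
  · intro x' _
    obtain ⟨W, hKW, hW, hWc⟩ := Set.exists_isOpen_lt_of_lt _ _ (h x')
    have hV : IsOpen (Prod.snd '' (K ∩ Prod.fst ⁻¹' Wᶜ))ᶜ :=
      ((hK.inter_right (hW.isClosed_compl.preimage continuous_fst)).image
        continuous_snd).isClosed.isOpen_compl
    obtain ⟨F, hF, hxF, hFV⟩ := exists_compact_subset hV (x := x') (by
      rintro ⟨⟨x, z⟩, ⟨hz, hzW⟩, rfl⟩
      exact hzW (hKW hz))
    refine ⟨F, mem_nhdsWithin_of_mem_nhds (mem_interior_iff_mem_nhds.1 hxF), (Wᶜ ×ˢ F)ᶜ,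
      (hW.isClosed_compl.prod hF.isClosed).isOpen_compl, ?_, η W, hWc, ?_⟩
    · exact fun p hp hpF ↦ hFV hpF.2 ⟨p, ⟨hp, hpF.1⟩, rfl⟩
    · intro z hz
      refine measure_mono fun x hx ↦ ?_
      by_contra hxW
      exact hx ⟨hxW, hz⟩

lemma measure_lt_half_of_lt_compl {X : Type*} [MeasurableSpace X] (η : Measure X)
    [IsFiniteMeasure η] {s : Set X} (hs : MeasurableSet s) (h : η s < η sᶜ) :
    η s < η Set.univ / 2 := by
  rw [ENNReal.lt_div_iff_mul_lt (by simp) (by simp), mul_two, ← measure_add_measure_compl hs]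
  exact ENNReal.add_lt_add_left (measure_ne_top _ _) h

/-- Proposition 6.6: let `X`, `X′` be compact metric spaces, `η`, `η′` finite Borel measures of
equal total mass, and `K ⊆ X × X′` compact. If for every `(x, x′)` the slices
`K(x′) = {y : (y,x′) ∈ K}` and `K′(x) = {y′ : (x,y′) ∈ K}` satisfy
`η (K(x′)) < η (X ∖ K(x′))` and `η′ (K′(x)) < η′ (X′ ∖ K′(x))`, then there exists a coupling of
`η` and `η′` vanishing on an open neighborhood of `K`. -/
theorem stmt11 {X X' : Type*} [MetricSpace X] [CompactSpace X] [MetricSpace X'] [CompactSpace X']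
    [MeasurableSpace X] [BorelSpace X] [MeasurableSpace X'] [BorelSpace X']
    (η : Measure X) (η' : Measure X') [IsFiniteMeasure η] [IsFiniteMeasure η']
    (hmass : η Set.univ = η' Set.univ)
    (K : Set (X × X')) (hK : IsCompact K)
    (h1 : ∀ x : X, ∀ x' : X', η {y | (y, x') ∈ K} < η {y | (y, x') ∈ K}ᶜ)
    (h2 : ∀ x : X, ∀ x' : X', η' {y' | (x, y') ∈ K} < η' {y' | (x, y') ∈ K}ᶜ) :
    ∃ ητ : Measure (X × X'), ητ.map Prod.fst = η ∧ ητ.map Prod.snd = η' ∧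
      ∃ U : Set (X × X'), IsOpen U ∧ K ⊆ U ∧ ητ U = 0 := by
  by_cases h0 : η Set.univ = 0
  · have e := Measure.measure_univ_eq_zero.1 h0
    have e' := Measure.measure_univ_eq_zero.1 (hmass.symm.trans h0)
    exact ⟨0, by simp [e], by simp [e'], Set.univ, isOpen_univ, Set.subset_univ _, by simp⟩
  have hX : Nonempty X := by
    by_contra hX
    rw [not_nonempty_iff] at hX
    exact h0 (by simp [Set.univ_eq_empty_iff.2 hX])
  have hX' : Nonempty X' := by
    by_contra hX'
    rw [not_nonempty_iff] at hX'
    exact h0 (by simp [hmass, Set.univ_eq_empty_iff.2 hX'])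
  have hc : 0 < η Set.univ / 2 := ENNReal.half_pos h0
  obtain ⟨U, hU, hKU, d, hd, hUd⟩ := exists_open_slices_le η hK hc fun x' ↦
    measure_lt_half_of_lt_compl η
      (hK.isClosed.preimage (by fun_prop : Continuous fun y : X ↦ (y, x'))).measurableSet
      (h1 hX.some x')
  obtain ⟨V, hV, hKV, e, he, hVe⟩ := exists_open_slices_le η' (hK.image continuous_swap) hc
    fun x ↦ by
      have hslice : {y' | (y', x) ∈ Prod.swap '' K} = {y' | (x, y') ∈ K} := by
        ext y'
        simp
      rw [hslice, hmass]
      exact measure_lt_half_of_lt_compl η'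
        (hK.isClosed.preimage (by fun_prop : Continuous fun y' : X' ↦ (x, y'))).measurableSet
        (h2 x hX'.some)
  have hW : IsOpen (U ∩ Prod.swap ⁻¹' V) := hU.inter (hV.preimage continuous_swap)
  obtain ⟨γ, hfst, hsnd, hγ⟩ := exists_coupling_null_of_slices_le hmass hW.measurableSet
    (h := max d e)
    (fun _ ↦ (measure_mono fun _ hx ↦ hx.1).trans ((hUd _).trans (le_max_left _ _)))
    (fun _ ↦ (measure_mono fun _ hx ↦ hx.2).trans ((hVe _).trans (le_max_right _ _)))
    (by
      rw [mul_comm]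
      exact (ENNReal.lt_div_iff_mul_lt (by simp) (by simp)).1 (max_lt hd he))
  exact ⟨γ, hfst, hsnd, _, hW,
    Set.subset_inter hKU fun p hp ↦ hKV (Set.mem_image_of_mem _ hp), hγ⟩
end

section
/- Let X be a compact metric space and η, η′ finite Borel measures on X with η(X) = η′(X) such that η({x}) < η(X ∖ {x}) and η′({x}) < η′(X ∖ {x}) for every x ∈ X. Then there exists a coupling η̃ of η and η′ that vanishes on an open neighborhood of the diagonal of X × X. Moreover, if η = η′ then the coupling η̃ may be chosen symmetric, i.e. invariant under the involution (x,x′) ↦ (x′,x). -/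
open MeasureTheory

/-- Cross-coupling the marginals of two finite measures `κ`, `θ` on a product, of the same
nonzero mass. -/
noncomputable def MeasureTheory.Measure.crossExchange {X : Type*} [MeasurableSpace X]
    (κ θ : Measure (X × X)) : Measure (X × X) :=
  (κ Set.univ)⁻¹ • ((κ.map Prod.fst).prod (θ.map Prod.snd) +
    (θ.map Prod.fst).prod (κ.map Prod.snd))

namespace MeasureTheory.Measure

section

variable {X : Type*} [MeasurableSpace X] {κ θ : Measure (X × X)}
  [IsFiniteMeasure κ] [IsFiniteMeasure θ]

lemma map_fst_crossExchange (h : θ Set.univ = κ Set.univ) (h0 : κ Set.univ ≠ 0) :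
    (crossExchange κ θ).map Prod.fst = κ.map Prod.fst + θ.map Prod.fst := by
  have key : (κ Set.univ)⁻¹ * κ Set.univ = 1 := ENNReal.inv_mul_cancel h0 (measure_ne_top _ _)
  rw [crossExchange, Measure.map_smul, Measure.map_add _ _ measurable_fst, Measure.map_fst_prod,
    Measure.map_fst_prod, Measure.map_apply measurable_snd .univ,
    Measure.map_apply measurable_snd .univ, Set.preimage_univ, h, ← smul_add, smul_smul, key,
    one_smul]

lemma map_snd_crossExchange (h : θ Set.univ = κ Set.univ) (h0 : κ Set.univ ≠ 0) :
    (crossExchange κ θ).map Prod.snd = κ.map Prod.snd + θ.map Prod.snd := by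
  have key : (κ Set.univ)⁻¹ * κ Set.univ = 1 := ENNReal.inv_mul_cancel h0 (measure_ne_top _ _)
  rw [crossExchange, Measure.map_smul, Measure.map_add _ _ measurable_snd, Measure.map_snd_prod,
    Measure.map_snd_prod, Measure.map_apply measurable_fst .univ,
    Measure.map_apply measurable_fst .univ, Set.preimage_univ, h, ← smul_add, smul_smul, key,
    one_smul, add_comm]

lemma map_swap_crossExchange (hκ : κ.map Prod.swap = κ) (hθ : θ.map Prod.swap = θ) :
    (crossExchange κ θ).map Prod.swap = crossExchange κ θ := by
  have marginals (μ : Measure (X × X)) (hμ : μ.map Prod.swap = μ) :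
      μ.map Prod.snd = μ.map Prod.fst := by
    conv_rhs => rw [← hμ, Measure.map_map measurable_fst measurable_swap]
    rfl
  rw [crossExchange, Measure.map_smul, Measure.map_add _ _ measurable_swap, Measure.prod_swap,
    Measure.prod_swap, marginals κ hκ, marginals θ hθ, add_comm]

lemma crossExchange_apply_eq_zero {A B : Set X} {N : Set (X × X)}
    (hA : MeasurableSet A) (hB : MeasurableSet B)
    (hκ : κ (A ×ˢ A)ᶜ = 0) (hθ : θ (Bᶜ ×ˢ Bᶜ)ᶜ = 0)
    (hN₁ : Disjoint N (A ×ˢ Bᶜ)) (hN₂ : Disjoint N (Bᶜ ×ˢ A)) :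
    crossExchange κ θ N = 0 := by
  have hκ₁ : κ.map Prod.fst Aᶜ = 0 := by
    rw [Measure.map_apply measurable_fst hA.compl]
    refine measure_mono_null (fun p hp => ?_) hκ
    exact fun h => hp h.1
  have hκ₂ : κ.map Prod.snd Aᶜ = 0 := by
    rw [Measure.map_apply measurable_snd hA.compl]
    refine measure_mono_null (fun p hp => ?_) hκ
    exact fun h => hp h.2
  have hθ₁ : θ.map Prod.fst B = 0 := by
    rw [Measure.map_apply measurable_fst hB]
    refine measure_mono_null (fun p hp => ?_) hθ
    exact fun h => h.1 hp
  have hθ₂ : θ.map Prod.snd B = 0 := by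
    rw [Measure.map_apply measurable_snd hB]
    refine measure_mono_null (fun p hp => ?_) hθ
    exact fun h => h.2 hp
  have z₁ : (κ.map Prod.fst).prod (θ.map Prod.snd) N = 0 := by
    refine measure_mono_null (t := Aᶜ ×ˢ Set.univ ∪ Set.univ ×ˢ B) (fun p hp => ?_)
      (measure_union_null (by simp [hκ₁]) (by simp [hθ₂]))
    have := Set.disjoint_left.1 hN₁ hp
    simp only [Set.mem_union, Set.mem_prod, Set.mem_compl_iff, Set.mem_univ] at this ⊢
    tauto
  have z₂ : (θ.map Prod.fst).prod (κ.map Prod.snd) N = 0 := by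
    refine measure_mono_null (t := B ×ˢ Set.univ ∪ Set.univ ×ˢ Aᶜ) (fun p hp => ?_)
      (measure_union_null (by simp [hθ₁]) (by simp [hκ₂]))
    have := Set.disjoint_left.1 hN₂ hp
    simp only [Set.mem_union, Set.mem_prod, Set.mem_compl_iff, Set.mem_univ] at this ⊢
    tauto
  simp [crossExchange, z₁, z₂]

end

lemma map_swap_restrict {X : Type*} [MeasurableSpace X] {γ : Measure (X × X)}
    (hγ : γ.map Prod.swap = γ) {S : Set (X × X)} (hS : MeasurableSet S)
    (hswap : Prod.swap ⁻¹' S = S) : (γ.restrict S).map Prod.swap = γ.restrict S := by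
  conv_rhs => rw [← hγ, Measure.restrict_map measurable_swap hS, hswap]

lemma prod_self_le_compl_prod_compl {X : Type*} [MeasurableSpace X] {γ : Measure (X × X)}
    [IsFiniteMeasure γ] {B : Set X} (hB : MeasurableSet B)
    (h : γ.map Prod.fst B + γ.map Prod.snd B ≤ γ Set.univ) :
    γ (B ×ˢ B) ≤ γ (Bᶜ ×ˢ Bᶜ) := by
  rw [Measure.map_apply measurable_fst hB, Measure.map_apply measurable_snd hB,
    ← measure_union_add_inter _ (measurable_snd hB),
    ← measure_add_measure_compl ((measurable_fst hB).union (measurable_snd hB))] at h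
  have hle := (ENNReal.add_le_add_iff_left (measure_ne_top _ _)).1 h
  have e : (Prod.fst ⁻¹' B ∪ Prod.snd ⁻¹' B : Set (X × X))ᶜ = Bᶜ ×ˢ Bᶜ := by
    ext p; simp
  rwa [e] at hle

/-- The mass that a coupling `γ` gives to the square `A ×ˢ A` can be exchanged with mass in
`Bᶜ ×ˢ Bᶜ`, so that it moves to `A ×ˢ Bᶜ` and `Bᶜ ×ˢ A`. -/
lemma exists_exchange_s12 {X : Type*} [MeasurableSpace X] (γ : Measure (X × X))
    [IsFiniteMeasure γ] {A B : Set X} (hA : MeasurableSet A) (hB : MeasurableSet B)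
    (hAB : A ⊆ B) (h : γ.map Prod.fst B + γ.map Prod.snd B ≤ γ Set.univ) :
    ∃ γ' : Measure (X × X), γ'.map Prod.fst = γ.map Prod.fst ∧
      γ'.map Prod.snd = γ.map Prod.snd ∧ (γ.map Prod.swap = γ → γ'.map Prod.swap = γ') ∧
      γ' (A ×ˢ A) = 0 ∧
      ∀ N, γ N = 0 → Disjoint N (A ×ˢ Bᶜ) → Disjoint N (Bᶜ ×ˢ A) → γ' N = 0 := by
  rcases eq_or_ne (γ (A ×ˢ A)) 0 with h0 | h0
  · exact ⟨γ, rfl, rfl, id, h0, fun N hN _ _ => hN⟩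
  set P : Set (X × X) := A ×ˢ A with hP
  set Q : Set (X × X) := Bᶜ ×ˢ Bᶜ with hQ
  have mP : MeasurableSet P := hA.prod hA
  have mQ : MeasurableSet Q := hB.compl.prod hB.compl
  have hPQ : γ P ≤ γ Q :=
    (measure_mono (Set.prod_mono hAB hAB)).trans (prod_self_le_compl_prod_compl hB h)
  have hQ0 : γ Q ≠ 0 := fun hz => h0 (le_antisymm (hPQ.trans hz.le) zero_le)
  have disj : Disjoint P Q := Set.disjoint_left.2 fun p hp hq => hq.1 (hAB hp.1)
  set c := γ P / γ Q with hc
  have hc1 : c ≤ 1 := ENNReal.div_le_of_le_mul (by simpa using hPQ)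
  have hctop : c ≠ ⊤ := ne_top_of_le_ne_top ENNReal.one_ne_top hc1
  set κ := γ.restrict P with hκ
  set θ := c • γ.restrict Q with hθ
  set ρ := γ.restrict (P ∪ Q)ᶜ + (1 - c) • γ.restrict Q with hρ
  have : IsFiniteMeasure θ := Measure.smul_finite _ hctop
  have κuniv : κ Set.univ = γ P := by simp [hκ]
  have θuniv : θ Set.univ = κ Set.univ := by
    simp [hθ, κuniv, hc, ENNReal.div_mul_cancel hQ0 (measure_ne_top _ _)]
  have κuniv0 : κ Set.univ ≠ 0 := by rwa [κuniv]
  have decomp : ρ + (κ + θ) = γ := by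
    have e : ρ + (κ + θ) =
        (γ.restrict P + ((1 - c) + c) • γ.restrict Q) + γ.restrict (P ∪ Q)ᶜ := by
      rw [add_smul]
      simp only [hρ, hκ, hθ]
      abel
    rw [e, tsub_add_cancel_of_le hc1, one_smul, ← Measure.restrict_union disj mQ,
      Measure.restrict_add_restrict_compl (mP.union mQ)]
  have hρle : ρ ≤ γ := by
    rw [← decomp]
    exact Measure.le_add_right le_rfl
  have κnull : κ (A ×ˢ A)ᶜ = 0 := by
    rw [hκ, Measure.restrict_apply mP.compl, Set.compl_inter_self, measure_empty]
  have θnull : θ (Bᶜ ×ˢ Bᶜ)ᶜ = 0 := by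
    rw [hθ, Measure.smul_apply, Measure.restrict_apply mQ.compl, Set.compl_inter_self,
      measure_empty, smul_zero]
  refine ⟨ρ + crossExchange κ θ, ?_, ?_, fun hs => ?_, ?_, fun N hN h₁ h₂ => ?_⟩
  · rw [Measure.map_add _ _ measurable_fst, map_fst_crossExchange θuniv κuniv0,
      ← Measure.map_add _ _ measurable_fst, ← Measure.map_add _ _ measurable_fst, decomp]
  · rw [Measure.map_add _ _ measurable_snd, map_snd_crossExchange θuniv κuniv0,
      ← Measure.map_add _ _ measurable_snd, ← Measure.map_add _ _ measurable_snd, decomp]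
  · have sP : Prod.swap ⁻¹' P = P := Set.preimage_swap_prod _ _
    have sQ : Prod.swap ⁻¹' Q = Q := Set.preimage_swap_prod _ _
    have tQ := map_swap_restrict hs mQ sQ
    rw [Measure.map_add _ _ measurable_swap,
      map_swap_crossExchange (map_swap_restrict hs mP sP) (by rw [hθ, Measure.map_smul, tQ]),
      hρ, Measure.map_add _ _ measurable_swap, Measure.map_smul, tQ,
      map_swap_restrict hs (mP.union mQ).compl
        (by rw [Set.preimage_compl, Set.preimage_union, sP, sQ])]
  · have hcross : crossExchange κ θ P = 0 :=
      crossExchange_apply_eq_zero hA hB κnull θnull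
        (Set.disjoint_left.2 fun p hp hq => hq.2 (hAB hp.2))
        (Set.disjoint_left.2 fun p hp hq => hq.1 (hAB hp.1))
    have hc₁ : (P ∩ (P ∪ Q)ᶜ) = ∅ :=
      Set.disjoint_iff_inter_eq_empty.1
        (Set.disjoint_left.2 fun p hp hq => hq (Or.inl hp))
    rw [Measure.add_apply, hcross, hρ, Measure.add_apply, Measure.smul_apply,
      Measure.restrict_apply mP, Measure.restrict_apply mP, hc₁,
      Set.disjoint_iff_inter_eq_empty.1 disj]
    simp
  · rw [Measure.add_apply, crossExchange_apply_eq_zero hA hB κnull θnull h₁ h₂, add_zero]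
    exact le_antisymm ((hρle N).trans hN.le) zero_le

end MeasureTheory.Measure

/-- If no point carries mass `M` or more, then uniformly small balls have mass less than `M`. -/
lemma exists_forall_measure_ball_lt {X : Type*} [MetricSpace X] [CompactSpace X]
    [MeasurableSpace X] [BorelSpace X] (μ : Measure X) [IsFiniteMeasure μ] {M : ENNReal}
    (h : ∀ x, μ {x} < M) : ∃ δ > 0, ∀ x, μ (Metric.ball x δ) < M := by
  choose U hU hUo hUlt using fun x => Set.exists_isOpen_lt_of_lt {x} M (h x)
  obtain ⟨δ, hδ, H⟩ := lebesgue_number_lemma_of_metric (s := Set.univ) isCompact_univ hUo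
    (fun x _ => Set.mem_iUnion.2 ⟨x, hU x rfl⟩)
  refine ⟨δ, hδ, fun x => ?_⟩
  obtain ⟨i, hi⟩ := H x trivial
  exact (measure_mono hi).trans_lt (hUlt i)

/-- A coupling which is symmetric when `η = η'` and which vanishes on finitely many small
squares. -/
lemma exists_coupling_ball_prod_ball_eq_zero {X : Type*} [MetricSpace X] [MeasurableSpace X]
    [BorelSpace X] (η η' : Measure X) [IsFiniteMeasure η] [IsFiniteMeasure η']
    (hmass : η Set.univ = η' Set.univ) (h0 : η Set.univ ≠ 0) {r : ℝ} (hr : 0 < r)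
    (hball : ∀ x, η (Metric.ball x (3 * r)) + η' (Metric.ball x (3 * r)) ≤ η Set.univ)
    (s : Finset X) :
    ∃ γ : Measure (X × X), γ.map Prod.fst = η ∧ γ.map Prod.snd = η' ∧
      (η = η' → γ.map Prod.swap = γ) ∧
      ∀ x ∈ s, γ (Metric.ball x r ×ˢ Metric.ball x r) = 0 := by
  classical
  induction s using Finset.induction_on with
  | empty =>
    have key : (η Set.univ)⁻¹ * η Set.univ = 1 := ENNReal.inv_mul_cancel h0 (measure_ne_top _ _)
    refine ⟨(η Set.univ)⁻¹ • η.prod η', ?_, ?_, ?_, by simp⟩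
    · rw [Measure.map_smul, Measure.map_fst_prod, ← hmass, smul_smul, key, one_smul]
    · rw [Measure.map_smul, Measure.map_snd_prod, smul_smul, key, one_smul]
    · rintro rfl
      rw [Measure.map_smul, Measure.prod_swap]
  | insert x s _ ih =>
    obtain ⟨γ, g₁, g₂, g₃, g₄⟩ := ih
    have guniv : γ Set.univ = η Set.univ := by
      rw [← g₁, Measure.map_apply measurable_fst .univ, Set.preimage_univ]
    have : IsFiniteMeasure γ := ⟨guniv ▸ measure_lt_top η _⟩
    obtain ⟨γ', e₁, e₂, e₃, e₄, e₅⟩ := γ.exists_exchange_s12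
      (A := Metric.ball x r) (B := Metric.ball x (3 * r)) measurableSet_ball measurableSet_ball
      (Metric.ball_subset_ball (by linarith)) (by rw [g₁, g₂, guniv]; exact hball x)
    refine ⟨γ', e₁.trans g₁, e₂.trans g₂, fun h => e₃ (g₃ h), fun y hy => ?_⟩
    rcases Finset.mem_insert.1 hy with rfl | hy
    · exact e₄
    have near {a b : X} (ha : a ∈ Metric.ball y r) (hb : b ∈ Metric.ball y r)
        (hax : a ∈ Metric.ball x r) : b ∈ Metric.ball x (3 * r) := by
      rw [Metric.mem_ball] at *
      have t₁ := dist_triangle b y x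
      have t₂ := dist_triangle_left y x a
      linarith
    exact e₅ _ (g₄ y hy)
      (Set.disjoint_left.2 fun p hp hq => hq.2 (near hp.1 hp.2 hq.1))
      (Set.disjoint_left.2 fun p hp hq => hq.1 (near hp.2 hp.1 hq.2))

/-- A single coupling vanishing near the diagonal which, when `η = η'`, is symmetric. -/
lemma exists_coupling_vanishing_near_diagonal {X : Type*} [MetricSpace X] [CompactSpace X]
    [MeasurableSpace X] [BorelSpace X] (η η' : Measure X) [IsFiniteMeasure η]
    [IsFiniteMeasure η'] (hmass : η Set.univ = η' Set.univ)
    (h1 : ∀ x : X, η {x} < η {x}ᶜ) (h2 : ∀ x : X, η' {x} < η' {x}ᶜ) :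
    ∃ γ : Measure (X × X), γ.map Prod.fst = η ∧ γ.map Prod.snd = η' ∧
      (η = η' → γ.map Prod.swap = γ) ∧
      ∃ U : Set (X × X), IsOpen U ∧ {p : X × X | p.1 = p.2} ⊆ U ∧ γ U = 0 := by
  rcases isEmpty_or_nonempty X with hX | ⟨⟨x₀⟩⟩
  · exact ⟨0, Subsingleton.elim _ _, Subsingleton.elim _ _, fun _ => Subsingleton.elim _ _,
      Set.univ, isOpen_univ, Set.subset_univ _, rfl⟩
  have h0 : η Set.univ ≠ 0 := fun h =>
    not_lt_zero ((h1 x₀).trans_le ((measure_mono (Set.subset_univ _)).trans h.le))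
  have hpt (x : X) : (η + η') {x} < η Set.univ := by
    have m : MeasurableSet {x} := measurableSet_singleton x
    rw [Measure.add_apply]
    rcases le_total (η {x}) (η' {x}) with h | h
    · rw [hmass, ← measure_add_measure_compl (μ := η') m, add_comm]
      exact ENNReal.add_lt_add_left (measure_ne_top _ _) (h.trans_lt (h2 x))
    · rw [← measure_add_measure_compl (μ := η) m]
      exact ENNReal.add_lt_add_left (measure_ne_top _ _) (h.trans_lt (h1 x))
  obtain ⟨δ, hδ, hball⟩ := exists_forall_measure_ball_lt (η + η') hpt
  have hr : 0 < δ / 3 := by positivity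
  obtain ⟨s, -, hs⟩ := (isCompact_univ (X := X)).elim_nhds_subcover
    (fun x => Metric.ball x (δ / 3)) (fun x _ => Metric.ball_mem_nhds x hr)
  obtain ⟨γ, g₁, g₂, g₃, g₄⟩ := exists_coupling_ball_prod_ball_eq_zero η η' hmass h0 hr
    (fun x => by rw [mul_div_cancel₀ δ three_ne_zero]; exact (hball x).le) s
  refine ⟨γ, g₁, g₂, g₃, ⋃ x ∈ s, Metric.ball x (δ / 3) ×ˢ Metric.ball x (δ / 3),
    isOpen_biUnion fun x _ => Metric.isOpen_ball.prod Metric.isOpen_ball, ?_,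
    (measure_biUnion_null_iff s.countable_toSet).2 g₄⟩
  rintro ⟨a, b⟩ (rfl : a = b)
  obtain ⟨x, hx, hax⟩ := Set.mem_iUnion₂.1 (hs (Set.mem_univ a))
  exact Set.mem_iUnion₂.2 ⟨x, hx, hax, hax⟩

/-- Corollary 6.11: let `X` be a compact metric space and `η`, `η′` finite Borel measures on `X`
of equal total mass with `η {x} < η (X ∖ {x})` and `η′ {x} < η′ (X ∖ {x})` for every `x`. Then
there is a coupling of `η` and `η′` vanishing on an open neighborhood of the diagonal; moreover,
if `η = η′` the coupling may be chosen symmetric (invariant under `(x,x′) ↦ (x′,x)`). -/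
theorem stmt12 {X : Type*} [MetricSpace X] [CompactSpace X] [MeasurableSpace X] [BorelSpace X]
    (η η' : Measure X) [IsFiniteMeasure η] [IsFiniteMeasure η']
    (hmass : η Set.univ = η' Set.univ)
    (h1 : ∀ x : X, η {x} < η {x}ᶜ) (h2 : ∀ x : X, η' {x} < η' {x}ᶜ) :
    (∃ ητ : Measure (X × X), ητ.map Prod.fst = η ∧ ητ.map Prod.snd = η' ∧
      ∃ U : Set (X × X), IsOpen U ∧ {p : X × X | p.1 = p.2} ⊆ U ∧ ητ U = 0) ∧
    (η = η' → ∃ ητ : Measure (X × X), ητ.map Prod.fst = η ∧ ητ.map Prod.snd = η' ∧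
      ητ.map Prod.swap = ητ ∧
      ∃ U : Set (X × X), IsOpen U ∧ {p : X × X | p.1 = p.2} ⊆ U ∧ ητ U = 0) := by
  obtain ⟨γ, g₁, g₂, g₃, hU⟩ := exists_coupling_vanishing_near_diagonal η η' hmass h1 h2
  exact ⟨⟨γ, g₁, g₂, hU⟩, fun h => ⟨γ, g₁, g₂, g₃ h, hU⟩⟩
end

section
/- Assume X is a compact metric space, 𝒯 is a Markov operator on X given by {σ_x}, and 𝒯̃ is a continuous self-coupling of 𝒯. Let η and η′ be 𝒯-invariant Borel probability measures on X. Then for any coupling η̃_0 of η and η′, every weak* accumulation point of the Cesàro averages η̃_n = (1/n) ∑_{j=0}^{n−1} (𝒯̃*)^j η̃_0 is a 𝒯̃-invariant coupling of η and η′. In particular, 𝒯̃-invariant couplings of η and η′ exist. -/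
open MeasureTheory ProbabilityTheory Filter Topology
open scoped ENNReal

namespace MeasureTheory

section CesaroAverage

variable {Y : Type*} [MeasurableSpace Y]

/-- The average of the first `n` measures of a sequence. -/
noncomputable def cesaroAverage (m : ℕ → Measure Y) (n : ℕ) : Measure Y :=
  (n : ℝ≥0∞)⁻¹ • ∑ j ∈ Finset.range n, m j

lemma isProbabilityMeasure_cesaroAverage (m : ℕ → Measure Y)
    [∀ j, IsProbabilityMeasure (m j)] {n : ℕ} (hn : n ≠ 0) :
    IsProbabilityMeasure (cesaroAverage m n) := by
  refine ⟨?_⟩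
  simp [cesaroAverage, ENNReal.inv_mul_cancel (Nat.cast_ne_zero.2 hn) (ENNReal.natCast_ne_top n)]

variable [TopologicalSpace Y] [OpensMeasurableSpace Y]

lemma integral_cesaroAverage (m : ℕ → Measure Y) [∀ j, IsProbabilityMeasure (m j)] (n : ℕ)
    (f : BoundedContinuousFunction Y ℝ) :
    ∫ q, f q ∂(cesaroAverage m n) = (n : ℝ)⁻¹ * ∑ j ∈ Finset.range n, ∫ q, f q ∂(m j) := by
  rw [cesaroAverage, integral_smul_measure,
    integral_finsetSum_measure fun j _ => f.integrable (m j)]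
  simp

variable {ι : Type*} {l : Filter ι} [l.NeBot] {φ : ι → ℕ} {m : ℕ → Measure Y}
  [∀ j, IsProbabilityMeasure (m j)] {lam : Measure Y}

/-- A test function with constant integral along the sequence has the same integral against any
limit of the Cesàro averages. -/
lemma integral_eq_of_tendsto_cesaroAverage (hφ : Tendsto φ l atTop)
    (f : BoundedContinuousFunction Y ℝ)
    (hlim : Tendsto (fun i => ∫ q, f q ∂(cesaroAverage m (φ i))) l (𝓝 (∫ q, f q ∂lam)))
    {c : ℝ} (hc : ∀ j, ∫ q, f q ∂(m j) = c) : ∫ q, f q ∂lam = c := by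
  refine tendsto_nhds_unique hlim (tendsto_const_nhds.congr' ?_)
  filter_upwards [hφ.eventually_ne_atTop 0] with i hi
  rw [integral_cesaroAverage]
  simp [hc, inv_mul_cancel_left₀ (Nat.cast_ne_zero.2 hi : (φ i : ℝ) ≠ 0)]

lemma isProbabilityMeasure_of_tendsto_cesaroAverage (hφ : Tendsto φ l atTop)
    (hlim : ∀ f : BoundedContinuousFunction Y ℝ,
      Tendsto (fun i => ∫ q, f q ∂(cesaroAverage m (φ i))) l (𝓝 (∫ q, f q ∂lam))) :
    IsProbabilityMeasure lam := by
  have h := integral_eq_of_tendsto_cesaroAverage hφ _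
    (hlim (BoundedContinuousFunction.const Y 1)) (c := 1) (by simp)
  refine ⟨?_⟩
  simpa [Measure.real, ENNReal.toReal_eq_one_iff] using h

lemma map_eq_of_tendsto_cesaroAverage {Z : Type*} [TopologicalSpace Z] [HasOuterApproxClosed Z]
    [MeasurableSpace Z] [BorelSpace Z] (hφ : Tendsto φ l atTop)
    (hlim : ∀ f : BoundedContinuousFunction Y ℝ,
      Tendsto (fun i => ∫ q, f q ∂(cesaroAverage m (φ i))) l (𝓝 (∫ q, f q ∂lam)))
    {g : Y → Z} (hg : Continuous g) (hgm : Measurable g) {ν : Measure Z} [IsFiniteMeasure ν]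
    (hm : ∀ j, (m j).map g = ν) : lam.map g = ν := by
  have := isProbabilityMeasure_of_tendsto_cesaroAverage hφ hlim
  refine ext_of_forall_integral_eq_of_IsFiniteMeasure fun f => ?_
  have hmap (μ : Measure Y) : ∫ z, f z ∂(μ.map g) = ∫ y, f (g y) ∂μ :=
    integral_map hgm.aemeasurable f.continuous.measurable.aestronglyMeasurable
  rw [hmap]
  exact integral_eq_of_tendsto_cesaroAverage hφ (f.compContinuous ⟨g, hg⟩) (hlim _)
    fun j => by rw [← hm j, hmap]; rfl

end CesaroAverage

section Kernel

variable {Y : Type*} [MeasurableSpace Y]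

lemma isProbabilityMeasure_iterate_bind (κ : Kernel Y Y) [IsMarkovKernel κ] (μ : Measure Y)
    [IsProbabilityMeasure μ] (j : ℕ) :
    IsProbabilityMeasure ((fun m : Measure Y => m.bind (fun p => κ p))^[j] μ) := by
  induction j with
  | zero => simpa
  | succ j ih =>
    rw [Function.iterate_succ_apply']
    exact inferInstanceAs (IsProbabilityMeasure (κ ∘ₘ _))

/-- A measurable map semiconjugating two kernels sends a measure with invariant image to measures
with the same image under all iterates. -/
lemma map_iterate_bind {Z : Type*} [MeasurableSpace Z] {κ : Kernel Y Y} {κ' : Kernel Z Z}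
    {g : Y → Z} (hg : Measurable g) (hκ : ∀ y, (κ y).map g = κ' (g y)) {μ : Measure Y}
    {ν : Measure Z} (hν : ν.bind (fun z => κ' z) = ν) (hμ : μ.map g = ν) (j : ℕ) :
    ((fun m : Measure Y => m.bind (fun p => κ p))^[j] μ).map g = ν := by
  induction j with
  | zero => simpa
  | succ j ih =>
    rw [Function.iterate_succ_apply']
    conv_rhs => rw [← hν, ← ih]
    ext s hs
    rw [Measure.map_apply hg hs, Measure.bind_apply (hg hs) κ.aemeasurable,
      Measure.bind_apply hs κ'.aemeasurable, lintegral_map (κ'.measurable_coe hs) hg]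
    simp [← hκ, Measure.map_apply hg hs]

variable [TopologicalSpace Y] [HasOuterApproxClosed Y] [BorelSpace Y]

/-- Krylov–Bogolyubov: a weak limit of the Cesàro averages of the iterates of a Feller Markov
kernel is invariant. -/
lemma bind_eq_of_tendsto_cesaroAverage {ι : Type*} {l : Filter ι} [l.NeBot] {φ : ι → ℕ}
    (hφ : Tendsto φ l atTop) (κ : Kernel Y Y) [IsMarkovKernel κ]
    (hcont : ∀ f : BoundedContinuousFunction Y ℝ, Continuous fun p => ∫ q, f q ∂(κ p))
    {μ : Measure Y} [IsProbabilityMeasure μ] {lam : Measure Y}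
    (hlim : ∀ f : BoundedContinuousFunction Y ℝ, Tendsto (fun i => ∫ q, f q ∂(cesaroAverage
      (fun j => (fun m : Measure Y => m.bind (fun p => κ p))^[j] μ) (φ i))) l
      (𝓝 (∫ q, f q ∂lam))) :
    lam.bind (fun p => κ p) = lam := by
  set m : ℕ → Measure Y := fun j => (fun m : Measure Y => m.bind (fun p => κ p))^[j] μ with hm
  have hprob (j : ℕ) : IsProbabilityMeasure (m j) := isProbabilityMeasure_iterate_bind κ μ j
  have := isProbabilityMeasure_of_tendsto_cesaroAverage hφ hlim
  have : IsProbabilityMeasure (lam.bind fun p => κ p) :=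
    inferInstanceAs (IsProbabilityMeasure (κ ∘ₘ lam))
  refine ext_of_forall_integral_eq_of_IsFiniteMeasure fun f => ?_
  have hbound (μ : Measure Y) [IsProbabilityMeasure μ] : ‖∫ q, f q ∂μ‖ ≤ ‖f‖ := by
    simpa using f.norm_integral_le_mul_norm μ
  have hbind (μ : Measure Y) [IsProbabilityMeasure μ] :
      ∫ q, f q ∂(μ.bind fun p => κ p) = ∫ p, ∫ q, f q ∂(κ p) ∂μ := by
    have hconst : κ ∘ₘ μ = (κ ∘ₖ Kernel.const Unit μ) () := Measure.comp_eq_comp_const_apply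
    change ∫ q, f q ∂(κ ∘ₘ μ) = _
    rw [hconst, Kernel.integral_comp (hconst ▸ f.integrable _), Kernel.const_apply]
  let Pf : BoundedContinuousFunction Y ℝ :=
    .ofNormedAddCommGroup (fun p => ∫ q, f q ∂(κ p)) (hcont f) ‖f‖ fun p => hbound (κ p)
  have hstep (j : ℕ) : ∫ p, Pf p ∂(m j) = ∫ q, f q ∂(m (j + 1)) := by
    simp only [hm, Function.iterate_succ_apply']
    exact (hbind (m j)).symm
  have hdiff : Tendsto (fun i => ∫ q, Pf q ∂(cesaroAverage m (φ i))
      - ∫ q, f q ∂(cesaroAverage m (φ i))) l (𝓝 0) := by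
    have hzero : Tendsto (fun i => (φ i : ℝ)⁻¹ * (‖f‖ + ‖f‖)) l (𝓝 0) := by
      simpa using ((tendsto_inv_atTop_nhds_zero_nat (𝕜 := ℝ)).comp hφ).mul_const (‖f‖ + ‖f‖)
    refine squeeze_zero_norm (fun i => ?_) hzero
    rw [integral_cesaroAverage, integral_cesaroAverage, ← mul_sub, ← Finset.sum_sub_distrib]
    simp only [hstep]
    rw [Finset.sum_range_sub (fun j => ∫ q, f q ∂(m j)), norm_mul, norm_inv, Real.norm_natCast]
    gcongr
    exact (norm_sub_le _ _).trans (add_le_add (hbound _) (hbound _))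
  rw [hbind lam, ← sub_eq_zero]
  exact tendsto_nhds_unique ((hlim Pf).sub (hlim f)) hdiff

end Kernel

/-- On a compact space, Cesàro averages of probability measures converge weakly along any
nonprincipal ultrafilter; the index is shifted to avoid the empty average. -/
lemma exists_tendsto_hyperfilter_cesaroAverage {Y : Type*} [MeasurableSpace Y]
    [TopologicalSpace Y] [T2Space Y] [CompactSpace Y] [BorelSpace Y] (m : ℕ → Measure Y)
    [∀ j, IsProbabilityMeasure (m j)] :
    ∃ lam : Measure Y, ∀ f : BoundedContinuousFunction Y ℝ,
      Tendsto (fun i => ∫ q, f q ∂(cesaroAverage m (i + 1))) (hyperfilter ℕ)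
        (𝓝 (∫ q, f q ∂lam)) := by
  let avg (n : ℕ) : ProbabilityMeasure Y :=
    ⟨cesaroAverage m (n + 1), isProbabilityMeasure_cesaroAverage m n.succ_ne_zero⟩
  obtain ⟨lam, -, hlam⟩ := isCompact_univ.ultrafilter_le_nhds ((hyperfilter ℕ).map avg) (by simp)
  exact ⟨lam, ProbabilityMeasure.tendsto_iff_forall_integral_tendsto.1 hlam⟩

end MeasureTheory

/-- Lemma 6.19: let `X` be a compact metric space, `𝒯` a Markov operator given by a Markov kernel
`κ`, and `𝒯̃` a continuous self-coupling of `𝒯` (a Markov kernel `κ̃` on `X × X`, weak*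
continuous, each `κ̃ (x,x′)` coupling `κ x` and `κ x′`). Let `η`, `η′` be `𝒯`-invariant
probability measures. Then for any coupling `η̃₀` of `η` and `η′`, every weak* accumulation point
of the Cesàro averages `η̃_n = n⁻¹ ∑_{j<n} (𝒯̃*)^j η̃₀` is a `𝒯̃`-invariant coupling of `η` and
`η′`; in particular `𝒯̃`-invariant couplings exist. -/
theorem stmt15 {X : Type*} [MetricSpace X] [CompactSpace X] [MeasurableSpace X] [BorelSpace X]
    (κ : Kernel X X) [IsMarkovKernel κ]
    (κt : Kernel (X × X) (X × X)) [IsMarkovKernel κt]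
    (hcoupling : ∀ p : X × X, (κt p).map Prod.fst = κ p.1 ∧ (κt p).map Prod.snd = κ p.2)
    (hcont : ∀ f : BoundedContinuousFunction (X × X) ℝ,
      Continuous fun p : X × X => ∫ q, f q ∂(κt p))
    (η η' : Measure X) [IsProbabilityMeasure η] [IsProbabilityMeasure η']
    (hη : η.bind (fun x => κ x) = η) (hη' : η'.bind (fun x => κ x) = η')
    (ηt0 : Measure (X × X)) (h0fst : ηt0.map Prod.fst = η) (h0snd : ηt0.map Prod.snd = η') :
    (∀ (lam : Measure (X × X)) (φ : ℕ → ℕ), StrictMono φ →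
      (∀ f : BoundedContinuousFunction (X × X) ℝ,
        Tendsto (fun i => ∫ q, f q ∂(((φ i : ℝ≥0∞))⁻¹ •
            ∑ j ∈ Finset.range (φ i),
              (fun m : Measure (X × X) => m.bind (fun p => κt p))^[j] ηt0))
          atTop (𝓝 (∫ q, f q ∂lam))) →
      lam.map Prod.fst = η ∧ lam.map Prod.snd = η' ∧ lam.bind (fun p => κt p) = lam) ∧
    ∃ lam : Measure (X × X), IsProbabilityMeasure lam ∧ lam.map Prod.fst = η ∧
      lam.map Prod.snd = η' ∧ lam.bind (fun p => κt p) = lam := by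
  have : IsProbabilityMeasure ηt0 := by
    refine ⟨?_⟩
    rw [← Set.preimage_univ (f := Prod.fst), ← Measure.map_apply measurable_fst .univ, h0fst]
    exact measure_univ
  set m : ℕ → Measure (X × X) :=
    fun j => (fun m : Measure (X × X) => m.bind (fun p => κt p))^[j] ηt0 with hm
  have hprob (j : ℕ) : IsProbabilityMeasure (m j) := isProbabilityMeasure_iterate_bind κt ηt0 j
  have key {l : Filter ℕ} [l.NeBot] {φ : ℕ → ℕ} {lam : Measure (X × X)} (hφ : Tendsto φ l atTop)
      (hlim : ∀ f : BoundedContinuousFunction (X × X) ℝ,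
        Tendsto (fun i => ∫ q, f q ∂(cesaroAverage m (φ i))) l (𝓝 (∫ q, f q ∂lam))) :
      lam.map Prod.fst = η ∧ lam.map Prod.snd = η' ∧ lam.bind (fun p => κt p) = lam :=
    ⟨map_eq_of_tendsto_cesaroAverage hφ hlim continuous_fst measurable_fst
        (map_iterate_bind measurable_fst (fun p => (hcoupling p).1) hη h0fst),
      map_eq_of_tendsto_cesaroAverage hφ hlim continuous_snd measurable_snd
        (map_iterate_bind measurable_snd (fun p => (hcoupling p).2) hη' h0snd),
      bind_eq_of_tendsto_cesaroAverage hφ κt hcont hlim⟩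
  refine ⟨fun lam φ hφ hlim => key hφ.tendsto_atTop hlim, ?_⟩
  obtain ⟨lam, hlam⟩ := exists_tendsto_hyperfilter_cesaroAverage m
  have hφ : Tendsto (fun i : ℕ => i + 1) (hyperfilter ℕ) atTop :=
    (tendsto_add_atTop_nat 1).mono_left Nat.hyperfilter_le_atTop
  exact ⟨lam, isProbabilityMeasure_of_tendsto_cesaroAverage hφ hlam, key hφ hlam⟩
end

section
/- Let 𝒯 be a Markov operator on a measurable space X, let X = A ∪ B be a partition of X into disjoint measurable sets, and let Ψ : X → [0,∞] be a measurable function for which there exist constants κ_A > 0 and κ_B > 0 satisfying 𝒯Ψ(x) ≤ Ψ(x) − κ_A for every x ∈ A and 𝒯Ψ(x) ≤ Ψ(x) + κ_B for every x ∈ B. Let ζ be any finite measure on X such that ∫_X Ψ dζ < ∞ and ∫_X 𝒯Ψ dζ ≥ ∫_X Ψ dζ. Then ζ(B) ≥ (κ_A/(κ_A + κ_B)) · ζ(X). In particular, this conclusion holds whenever ζ is 𝒯-invariant and ∫ Ψ dζ < ∞. -/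
open MeasureTheory ProbabilityTheory
open scoped ENNReal

/-- Integrated drift inequality: a Margulis function that does not decrease on average balances
the mass of the region of decrease against the mass of the region of bounded increase. -/
theorem ofReal_mul_measure_le_of_drift {X : Type*} [MeasurableSpace X] {ζ : Measure X}
    {A B : Set X} (hA : MeasurableSet A) (hB : MeasurableSet B)
    (hdisj : Disjoint A B) (hcover : A ∪ B = Set.univ) {Φ Ψ : X → ℝ≥0∞} {a b : ℝ≥0∞}
    (hAineq : ∀ x ∈ A, Φ x + a ≤ Ψ x) (hBineq : ∀ x ∈ B, Φ x ≤ Ψ x + b)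
    (hfin : ∫⁻ x, Ψ x ∂ζ ≠ ∞) (hle : ∫⁻ x, Ψ x ∂ζ ≤ ∫⁻ x, Φ x ∂ζ) :
    a * ζ A ≤ b * ζ B := by
  have hpt : ∀ x, Φ x + A.indicator (fun _ => a) x ≤ Ψ x + B.indicator (fun _ => b) x := by
    intro x
    rcases (hcover.symm ▸ Set.mem_univ x : x ∈ A ∪ B) with hx | hx
    · simpa [hx, hdisj.notMem_of_mem_left hx] using hAineq x hx
    · simpa [hx, hdisj.notMem_of_mem_right hx] using hBineq x hx
  have hint := lintegral_mono (μ := ζ) hpt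
  rw [lintegral_add_right _ (measurable_const.indicator hA),
    lintegral_add_right _ (measurable_const.indicator hB),
    lintegral_indicator_const hA, lintegral_indicator_const hB] at hint
  exact (ENNReal.add_le_add_iff_left hfin).1 ((add_le_add_left hle _).trans hint)

/-- Lemma 6.21: let `𝒯` be a Markov operator (Markov kernel `κ`) on a measurable space `X`,
`X = A ∪ B` a partition into disjoint measurable sets, and `Ψ : X → [0,∞]` a measurable
(additive) Margulis function: there are `κ_A, κ_B > 0` with `𝒯Ψ(x) ≤ Ψ(x) − κ_A` on `A` and
`𝒯Ψ(x) ≤ Ψ(x) + κ_B` on `B`. If `ζ` is a finite measure with `∫ Ψ dζ < ∞` and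
`∫ 𝒯Ψ dζ ≥ ∫ Ψ dζ`, then `ζ B ≥ (κ_A/(κ_A + κ_B)) · ζ X`. In particular this holds whenever
`ζ` is `𝒯`-invariant with `∫ Ψ dζ < ∞`. -/
theorem stmt16 {X : Type*} [MeasurableSpace X] (κ : Kernel X X) [IsMarkovKernel κ]
    (A B : Set X) (hA : MeasurableSet A) (hB : MeasurableSet B)
    (hdisj : Disjoint A B) (hcover : A ∪ B = Set.univ)
    (Ψ : X → ℝ≥0∞) (hΨ : Measurable Ψ) (κA κB : ℝ) (hκA : 0 < κA) (hκB : 0 < κB)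
    (hAineq : ∀ x ∈ A, (∫⁻ y, Ψ y ∂(κ x)) + ENNReal.ofReal κA ≤ Ψ x)
    (hBineq : ∀ x ∈ B, (∫⁻ y, Ψ y ∂(κ x)) ≤ Ψ x + ENNReal.ofReal κB) :
    (∀ ζ : Measure X, IsFiniteMeasure ζ → (∫⁻ x, Ψ x ∂ζ) < ∞ →
      (∫⁻ x, Ψ x ∂ζ) ≤ ∫⁻ x, ∫⁻ y, Ψ y ∂(κ x) ∂ζ →
      κA / (κA + κB) * (ζ Set.univ).toReal ≤ (ζ B).toReal) ∧
    (∀ ζ : Measure X, IsFiniteMeasure ζ → (∫⁻ x, Ψ x ∂ζ) < ∞ →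
      ζ.bind (fun x => κ x) = ζ →
      κA / (κA + κB) * (ζ Set.univ).toReal ≤ (ζ B).toReal) := by
  have key : ∀ ζ : Measure X, IsFiniteMeasure ζ → (∫⁻ x, Ψ x ∂ζ) < ∞ →
      (∫⁻ x, Ψ x ∂ζ) ≤ ∫⁻ x, ∫⁻ y, Ψ y ∂(κ x) ∂ζ →
      κA / (κA + κB) * (ζ Set.univ).toReal ≤ (ζ B).toReal := by
    intro ζ _ hfin hle
    have hmass := ofReal_mul_measure_le_of_drift hA hB hdisj hcover hAineq hBineq hfin.ne hle
    have hreal := ENNReal.toReal_mono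
      (ENNReal.mul_ne_top ENNReal.ofReal_ne_top (measure_ne_top ζ B)) hmass
    rw [ENNReal.toReal_mul, ENNReal.toReal_mul, ENNReal.toReal_ofReal hκA.le,
      ENNReal.toReal_ofReal hκB.le] at hreal
    rw [← hcover, measure_union hdisj hB,
      ENNReal.toReal_add (measure_ne_top ζ A) (measure_ne_top ζ B), div_mul_eq_mul_div,
      div_le_iff₀ (add_pos hκA hκB)]
    linarith
  refine ⟨key, fun ζ hζ hfin hinv => key ζ hζ hfin ?_⟩
  rw [← Measure.lintegral_bind κ.measurable.aemeasurable hΨ.aemeasurable, hinv]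
end

section
/- Let 𝒯 be a Markov operator on a measurable space X and ψ : X → [0,∞] a measurable function. Suppose there exist real constants κ_A, κ′_B, κ″_B with κ_A + κ″_B > 0 and pairwise disjoint measurable sets A, B′, B″ with X = A ∪ B′ ∪ B″ such that: (i) 𝒯ψ(x) ≤ ψ(x) − κ_A for x ∈ A; (ii) 𝒯ψ(x) ≤ ψ(x) + κ′_B for x ∈ B′; (iii) 𝒯ψ(x) ≤ ψ(x) + κ″_B for x ∈ B″. Let η̂ be a finite measure on X with ∫ ψ dη̂ < ∞ and ∫_X 𝒯ψ dη̂ ≥ ∫_X ψ dη̂. Then η̂(B″) ≥ (κ_A · η̂(X) − (κ_A + κ′_B) · η̂(B′)) / (κ_A + κ″_B). -/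
open MeasureTheory ProbabilityTheory
open scoped ENNReal

/-- If `f + c⁻ ≤ g + c⁺` pointwise, where `g` has finite integral and `∫ g ≤ ∫ f`, then the real
function `c` has nonnegative integral. -/
theorem integral_nonneg_of_add_ofReal_neg_le {X : Type*} [MeasurableSpace X] {μ : Measure X}
    {f g : X → ℝ≥0∞} {c : X → ℝ} (hg : Measurable g) (hc : Integrable c μ) (hcm : Measurable c)
    (hle : ∀ x, f x + ENNReal.ofReal (-c x) ≤ g x + ENNReal.ofReal (c x))
    (hfin : ∫⁻ x, g x ∂μ < ∞) (hfg : ∫⁻ x, g x ∂μ ≤ ∫⁻ x, f x ∂μ) :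
    0 ≤ ∫ x, c x ∂μ := by
  have hsum : (∫⁻ x, g x ∂μ) + ∫⁻ x, ENNReal.ofReal (-c x) ∂μ ≤
      (∫⁻ x, g x ∂μ) + ∫⁻ x, ENNReal.ofReal (c x) ∂μ := by
    calc _ ≤ (∫⁻ x, f x ∂μ) + ∫⁻ x, ENNReal.ofReal (-c x) ∂μ := by gcongr
      _ = ∫⁻ x, f x + ENNReal.ofReal (-c x) ∂μ :=
        (lintegral_add_right _ hcm.neg.ennreal_ofReal).symm
      _ ≤ ∫⁻ x, g x + ENNReal.ofReal (c x) ∂μ := lintegral_mono hle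
      _ = _ := lintegral_add_left hg _
  have hneg := (ENNReal.add_le_add_iff_left hfin.ne).1 hsum
  rw [integral_eq_lintegral_pos_part_sub_lintegral_neg_part hc, sub_nonneg]
  exact ENNReal.toReal_mono hc.lintegral_lt_top.ne hneg

/-- Lemma 11.3: let `𝒯` be a Markov operator (Markov kernel `κ`) on a measurable space `X` and
`ψ : X → [0,∞]` measurable. Suppose there are real constants `κ_A, κ′_B, κ″_B` with
`κ_A + κ″_B > 0` and a partition `X = A ∪ B′ ∪ B″` into pairwise disjoint measurable sets with
`𝒯ψ ≤ ψ − κ_A` on `A`, `𝒯ψ ≤ ψ + κ′_B` on `B′`, `𝒯ψ ≤ ψ + κ″_B` on `B″`.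
(The inequality `a ≤ b + r` for a real constant `r` of arbitrary sign is encoded in `[0,∞]` as
`a + ofReal (−r) ≤ b + ofReal r`.) If `η̂` is a finite measure with `∫ ψ dη̂ < ∞` and
`∫ 𝒯ψ dη̂ ≥ ∫ ψ dη̂`, then
`η̂ B″ ≥ (κ_A · η̂ X − (κ_A + κ′_B) · η̂ B′) / (κ_A + κ″_B)`. -/
theorem stmt17 {X : Type*} [MeasurableSpace X] (κ : Kernel X X) [IsMarkovKernel κ]
    (ψ : X → ℝ≥0∞) (hψ : Measurable ψ) (κA κB' κB'' : ℝ) (hpos : 0 < κA + κB'')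
    (A B' B'' : Set X) (hA : MeasurableSet A) (hB' : MeasurableSet B')
    (hB'' : MeasurableSet B'')
    (hAB' : Disjoint A B') (hAB'' : Disjoint A B'') (hB'B'' : Disjoint B' B'')
    (hcover : A ∪ B' ∪ B'' = Set.univ)
    (hAineq : ∀ x ∈ A,
      (∫⁻ y, ψ y ∂(κ x)) + ENNReal.ofReal κA ≤ ψ x + ENNReal.ofReal (-κA))
    (hB'ineq : ∀ x ∈ B',
      (∫⁻ y, ψ y ∂(κ x)) + ENNReal.ofReal (-κB') ≤ ψ x + ENNReal.ofReal κB')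
    (hB''ineq : ∀ x ∈ B'',
      (∫⁻ y, ψ y ∂(κ x)) + ENNReal.ofReal (-κB'') ≤ ψ x + ENNReal.ofReal κB'')
    (ηh : Measure X) [IsFiniteMeasure ηh] (hfin : (∫⁻ x, ψ x ∂ηh) < ∞)
    (hgrow : (∫⁻ x, ψ x ∂ηh) ≤ ∫⁻ x, ∫⁻ y, ψ y ∂(κ x) ∂ηh) :
    (κA * (ηh Set.univ).toReal - (κA + κB') * (ηh B').toReal) / (κA + κB'') ≤
      (ηh B'').toReal := by
  let c : X → ℝ := A.indicator (fun _ ↦ -κA) + B'.indicator (fun _ ↦ κB') +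
    B''.indicator (fun _ ↦ κB'')
  have hiA : Integrable (A.indicator fun _ ↦ -κA) ηh := (integrable_const _).indicator hA
  have hiB' : Integrable (B'.indicator fun _ ↦ κB') ηh := (integrable_const _).indicator hB'
  have hiB'' : Integrable (B''.indicator fun _ ↦ κB'') ηh := (integrable_const _).indicator hB''
  have hcm : Measurable c := ((measurable_const.indicator hA).add
    (measurable_const.indicator hB')).add (measurable_const.indicator hB'')
  have hle : ∀ x, (∫⁻ y, ψ y ∂(κ x)) + ENNReal.ofReal (-c x) ≤ ψ x + ENNReal.ofReal (c x) := by
    intro x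
    have hx : x ∈ A ∪ B' ∪ B'' := hcover ▸ Set.mem_univ x
    rcases hx with (hx | hx) | hx
    · simpa [c, hx, hAB'.notMem_of_mem_left hx, hAB''.notMem_of_mem_left hx] using hAineq x hx
    · simpa [c, hx, hAB'.notMem_of_mem_right hx, hB'B''.notMem_of_mem_left hx]
        using hB'ineq x hx
    · simpa [c, hx, hAB''.notMem_of_mem_right hx, hB'B''.notMem_of_mem_right hx]
        using hB''ineq x hx
  have hint : ∫ x, c x ∂ηh = ηh.real A * -κA + ηh.real B' * κB' + ηh.real B'' * κB'' := by
    simp only [c]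
    rw [integral_add' (hiA.add hiB') hiB'', integral_add' hiA hiB',
      integral_indicator_const _ hA, integral_indicator_const _ hB',
      integral_indicator_const _ hB'']
    simp only [smul_eq_mul]
  have huniv : ηh.real Set.univ = ηh.real A + ηh.real B' + ηh.real B'' := by
    rw [← hcover, measureReal_union (hAB''.union_left hB'B'') hB'', measureReal_union hAB' hB']
  have hnonneg := integral_nonneg_of_add_ofReal_neg_le (c := c) hψ ((hiA.add hiB').add hiB'') hcm hle
    hfin hgrow
  rw [hint] at hnonneg
  simp only [← measureReal_def]
  rw [div_le_iff₀ hpos, huniv]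
  linarith
end
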